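/- General overlap concentration: In the general perturbed Bayesian inference model, suppose v_n(s_n) → 0 and n·s_n → +∞ as n → ∞. Then ∫₁² E⟨(x⁽¹⁾·x⁽²⁾ − E⟨x⁽¹⁾·x⁽²⁾⟩)²⟩ da → 0 as n → ∞, where x⁽¹⁾ and x⁽²⁾ are two independent replicas sampled from the perturbed Gibbs measure ⟨·⟩ and x⁽¹⁾·x⁽²⁾ = (1/n)·Σᵢ x_i⁽¹⁾·x_i⁽²⁾. -/

import Mathlib

open MeasureTheory ProbabilityTheory Filter Real
open scoped Topology

noncomputable section

/-- Standard Gaussian measure on `ℝ`. -/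
def stdG : Measure ℝ := gaussianReal 0 1

/-- Law of a vector of `n` i.i.d. standard Gaussians. -/
def gvec (n : ℕ) : Measure (Fin n → ℝ) := Measure.pi fun _ => stdG

/-- Rescaled scalar product `x·y = (1/n)·Σᵢ xᵢyᵢ`. -/
def ovl (n : ℕ) (x y : Fin n → ℝ) : ℝ := (1 / (n : ℝ)) * ∑ i, x i * y i

/-- Perturbation Hamiltonian
`h_{n,a}(x) = Σᵢ a√sₙ·zᵢ·xᵢ + a²sₙ·xᵢ·Xᵢ − a²sₙ·xᵢ²/2`. -/
def hPert (n : ℕ) (sn a : ℝ) (X z x : Fin n → ℝ) : ℝ :=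
  ∑ i : Fin n,
    (a * Real.sqrt sn * z i * x i + a ^ 2 * sn * x i * X i - a ^ 2 * sn * x i ^ 2 / 2)

/-- Joint law of `((X,Y),z)` where `z` is an independent Gaussian vector. -/
def pertSpace {𝒴 : Type*} [MeasurableSpace 𝒴] (n : ℕ)
    (ν : Measure ((Fin n → ℝ) × 𝒴)) [IsProbabilityMeasure ν] :
    Measure (((Fin n → ℝ) × 𝒴) × (Fin n → ℝ)) :=
  ν.prod (gvec n)

/-- Perturbed partition function
`∫ W(x,Y)·e^{h_{n,a}(x)} dP₁(x)` (where `W(x,y) = e^{H_n(x,y)}`). -/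
def Zpert {𝒴 : Type*} [MeasurableSpace 𝒴] (n : ℕ) (P : Measure (Fin n → ℝ))
    (W : (Fin n → ℝ) → 𝒴 → ℝ) (sn a : ℝ)
    (ω : ((Fin n → ℝ) × 𝒴) × (Fin n → ℝ)) : ℝ :=
  ∫ x, W x ω.1.2 * Real.exp (hPert n sn a ω.1.1 ω.2 x) ∂P

/-- Unperturbed free energy `F_n = (1/n)·E[log Z_n(Y)]`. -/
def FEgen {𝒴 : Type*} [MeasurableSpace 𝒴] (n : ℕ) (P : Measure (Fin n → ℝ))
    (W : (Fin n → ℝ) → 𝒴 → ℝ) (ν : Measure ((Fin n → ℝ) × 𝒴)) : ℝ :=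
  (1 / (n : ℝ)) * ∫ y, Real.log (∫ x, W x y ∂P) ∂(ν.map Prod.snd)

/-- Perturbed free energy `F_n^{(pert)}(a)`. -/
def FEpert {𝒴 : Type*} [MeasurableSpace 𝒴] (n : ℕ) (P : Measure (Fin n → ℝ))
    (W : (Fin n → ℝ) → 𝒴 → ℝ) (ν : Measure ((Fin n → ℝ) × 𝒴)) [IsProbabilityMeasure ν]
    (sn a : ℝ) : ℝ :=
  (1 / (n : ℝ)) * ∫ ω, Real.log (Zpert n P W sn a ω) ∂(pertSpace n ν)

/-- Perturbed Gibbs expectation `⟨f(x)⟩`. -/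
def gibbsPert {𝒴 : Type*} [MeasurableSpace 𝒴] (n : ℕ) (P : Measure (Fin n → ℝ))
    (W : (Fin n → ℝ) → 𝒴 → ℝ) (sn a : ℝ)
    (ω : ((Fin n → ℝ) × 𝒴) × (Fin n → ℝ)) (f : (Fin n → ℝ) → ℝ) : ℝ :=
  (∫ x, f x * (W x ω.1.2 * Real.exp (hPert n sn a ω.1.1 ω.2 x)) ∂P)
    / Zpert n P W sn a ω

/-- The function `φ(a) = (1/(n·sₙ))·log ∫ e^{H^{(pert)}} dP₁`. -/
def phiPert {𝒴 : Type*} [MeasurableSpace 𝒴] (n : ℕ) (P : Measure (Fin n → ℝ))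
    (W : (Fin n → ℝ) → 𝒴 → ℝ) (sn a : ℝ)
    (ω : ((Fin n → ℝ) × 𝒴) × (Fin n → ℝ)) : ℝ :=
  (1 / ((n : ℝ) * sn)) * Real.log (Zpert n P W sn a ω)

/-- `v_n(s_n) = sup_{1/2 ≤ a ≤ 3} E|φ(a) − E φ(a)|`. -/
def vnPert {𝒴 : Type*} [MeasurableSpace 𝒴] (n : ℕ) (P : Measure (Fin n → ℝ))
    (W : (Fin n → ℝ) → 𝒴 → ℝ) (ν : Measure ((Fin n → ℝ) × 𝒴)) [IsProbabilityMeasure ν]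
    (sn : ℝ) : ℝ :=
  ⨆ a : Set.Icc (1 / 2 : ℝ) 3,
    ∫ ω, |phiPert n P W sn a ω - ∫ ω', phiPert n P W sn a ω' ∂(pertSpace n ν)|
      ∂(pertSpace n ν)

/-- `E⟨x⁽¹⁾·x⁽²⁾⟩` under the perturbed Gibbs measure. -/
def meanOv {𝒴 : Type*} [MeasurableSpace 𝒴] (n : ℕ) (P : Measure (Fin n → ℝ))
    (W : (Fin n → ℝ) → 𝒴 → ℝ) (ν : Measure ((Fin n → ℝ) × 𝒴)) [IsProbabilityMeasure ν]
    (sn a : ℝ) : ℝ :=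
  ∫ ω, gibbsPert n P W sn a ω
      (fun x1 => gibbsPert n P W sn a ω (fun x2 => ovl n x1 x2)) ∂(pertSpace n ν)

instance : IsProbabilityMeasure stdG := by unfold stdG; infer_instance
instance (n : ℕ) : IsProbabilityMeasure (gvec n) := by unfold gvec; infer_instance

lemma stdG_shift (v : ℝ) :
    stdG.map (fun z => z + v) =
      stdG.withDensity (fun z => ENNReal.ofReal (Real.exp (v * z - v ^ 2 / 2))) := by
  unfold stdG
  rw [gaussianReal_map_add_const, gaussianReal_of_var_ne_zero _ one_ne_zero,
    gaussianReal_of_var_ne_zero _ one_ne_zero, ← withDensity_mul _ (by fun_prop) (by fun_prop)]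
  congr 1
  ext z
  simp only [Pi.mul_apply, gaussianPDF]
  rw [← ENNReal.ofReal_mul (gaussianPDFReal_nonneg _ _ _)]
  congr 1
  simp only [gaussianPDFReal]
  rw [mul_assoc _ (Real.exp _) (Real.exp _), ← Real.exp_add]
  congr 2
  simp
  ring

lemma stdG_exp_integrable (v : ℝ) : Integrable (fun z => Real.exp (v * z)) stdG := by
  unfold stdG; exact integrable_exp_mul_gaussianReal v

lemma gvec_exp_integrable {n : ℕ} (v : Fin n → ℝ) (c : ℝ) :
    Integrable (fun z : Fin n → ℝ => Real.exp (∑ i, v i * z i - c)) (gvec n) := by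
  have h : Integrable (fun z : Fin n → ℝ => ∏ i, Real.exp (v i * z i)) (gvec n) := by
    unfold gvec
    exact Integrable.fintype_prod_dep (f := fun i z => Real.exp (v i * z))
      (fun i => stdG_exp_integrable (v i))
  simp_rw [sub_eq_add_neg, Real.exp_add, Real.exp_sum]
  exact h.mul_const _

lemma gvec_shift {n : ℕ} (v : Fin n → ℝ) :
    (gvec n).map (fun z => z + v) =
      (gvec n).withDensity
        (fun z => ENNReal.ofReal (Real.exp (∑ i, v i * z i - ∑ i, v i ^ 2 / 2))) := by
  have h1 : (gvec n).map (fun z => z + v) = Measure.pi (fun i => stdG.map (fun z => z + v i)) := by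
    unfold gvec
    have : ∀ i, IsProbabilityMeasure (stdG.map (fun z => z + v i)) := fun i =>
      Measure.isProbabilityMeasure_map (by fun_prop)
    exact Measure.pi_map_pi (μ := fun _ : Fin n => stdG) (f := fun i (z : ℝ) => z + v i)
      (fun i => Measurable.aemeasurable (by fun_prop))
  have : ∀ i, IsProbabilityMeasure (stdG.map (fun z => z + v i)) := fun i =>
      Measure.isProbabilityMeasure_map (by fun_prop)
  rw [h1]
  apply Measure.pi_eq
  intro S hS
  have hpi : MeasurableSet (Set.univ.pi S) := MeasurableSet.univ_pi hS
  rw [withDensity_apply _ hpi, ← ofReal_integral_eq_lintegral_ofReal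
    (gvec_exp_integrable v _).integrableOn (ae_of_all _ fun _ => (Real.exp_pos _).le),
    ← integral_indicator hpi]
  have h2 : ∀ z : Fin n → ℝ, (Set.univ.pi S).indicator
      (fun z => Real.exp (∑ i, v i * z i - ∑ i, v i ^ 2 / 2)) z
      = ∏ i, (S i).indicator (fun z => Real.exp (v i * z - v i ^ 2 / 2)) (z i) := by
    intro z
    by_cases hz : z ∈ Set.univ.pi S
    · rw [Set.indicator_of_mem hz, ← Finset.sum_sub_distrib, Real.exp_sum]
      refine Finset.prod_congr rfl fun i _ => ?_
      rw [Set.indicator_of_mem (hz i (Set.mem_univ i))]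
    · rw [Set.indicator_of_notMem hz]
      simp only [Set.mem_univ_pi, not_forall] at hz
      obtain ⟨i, hi⟩ := hz
      symm
      apply Finset.prod_eq_zero (Finset.mem_univ i)
      rw [Set.indicator_of_notMem hi]
  simp_rw [h2]
  unfold gvec
  rw [integral_fintype_prod_eq_prod (f := fun i => (S i).indicator
    (fun z => Real.exp (v i * z - v i ^ 2 / 2))), ENNReal.ofReal_prod_of_nonneg]
  · refine Finset.prod_congr rfl fun i _ => ?_
    rw [stdG_shift, withDensity_apply _ (hS i), integral_indicator (hS i),
      ofReal_integral_eq_lintegral_ofReal]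
    · have := (stdG_exp_integrable (v i)).mul_const (Real.exp (-(v i ^ 2 / 2)))
      simp_rw [← Real.exp_add, ← sub_eq_add_neg] at this
      exact this.integrableOn
    · exact ae_of_all _ fun _ => (Real.exp_pos _).le
  · intro i _
    exact integral_nonneg fun z => Set.indicator_nonneg (fun _ _ => (Real.exp_pos _).le) _

lemma gvec_shift_lintegral {n : ℕ} (v : Fin n → ℝ) (f : (Fin n → ℝ) → ENNReal)
    (hf : Measurable f) :
    ∫⁻ z, f (z + v) ∂(gvec n) =
      ∫⁻ z, ENNReal.ofReal (Real.exp (∑ i, v i * z i - ∑ i, v i ^ 2 / 2)) * f z ∂(gvec n) := by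
  rw [← lintegral_map (f := f) (g := fun z => z + v) hf (by fun_prop), gvec_shift,
    lintegral_withDensity_eq_lintegral_mul _ (by fun_prop) hf]
  rfl

lemma gvec_shift_integral {n : ℕ} (v : Fin n → ℝ) (f : (Fin n → ℝ) → ℝ)
    (hf : Measurable f) :
    ∫ z, f (z + v) ∂(gvec n) =
      ∫ z, Real.exp (∑ i, v i * z i - ∑ i, v i ^ 2 / 2) * f z ∂(gvec n) := by
  rw [← integral_map (f := f) (φ := fun z => z + v) (by fun_prop) hf.aestronglyMeasurable,
    gvec_shift, integral_withDensity_eq_integral_toReal_smul (by fun_prop) (by simp)]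
  simp [ENNReal.toReal_ofReal (Real.exp_pos _).le]

lemma gvec_abs_integrable {n : ℕ} (i : Fin n) : Integrable (fun z : Fin n → ℝ => |z i|) (gvec n) := by
  have h := (gvec_exp_integrable (Pi.single i (1:ℝ)) 0).add
    (gvec_exp_integrable (Pi.single i (-1:ℝ)) 0)
  refine h.mono' (Measurable.aestronglyMeasurable ((measurable_pi_apply i).abs))
    (ae_of_all _ fun z => ?_)
  have e1 : ∀ c : ℝ, ∑ j, (Pi.single i c : Fin n → ℝ) j * z j = c * z i := by
    intro c
    rw [Finset.sum_eq_single i] <;> simp +contextual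
  simp only [Pi.add_apply, e1]
  simp only [norm_eq_abs, abs_abs, one_mul, sub_zero, neg_mul]
  have h1 := Real.add_one_le_exp (z i)
  have h2 := Real.add_one_le_exp (- z i)
  have h3 := Real.exp_pos (z i)
  have h4 := Real.exp_pos (- z i)
  rcases abs_cases (z i) with ⟨h, _⟩ | ⟨h, _⟩ <;> rw [h] <;> linarith

/-- Gaussian integration by parts along a fixed direction. -/
lemma gvec_ibp {n : ℕ} (v : Fin n → ℝ) (g g' : (Fin n → ℝ) → ℝ) (C : ℝ)
    (hg : Measurable g) (hg' : Measurable g') (hC : ∀ z, |g z| ≤ C) (hC' : ∀ z, |g' z| ≤ C)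
    (hd : ∀ z, HasDerivAt (fun t : ℝ => g (z + t • v)) (g' z) 0) :
    ∫ z, (∑ i, v i * z i) * g z ∂(gvec n) = ∫ z, g' z ∂(gvec n) := by
  have hd2 : ∀ z (t : ℝ), HasDerivAt (fun t : ℝ => g (z + t • v)) (g' (z + t • v)) t := by
    intro z t
    have h := hd (z + t • v)
    have h2 := HasDerivAt.comp_sub_const (x := t) t (f := fun u : ℝ => g (z + t • v + u • v))
      (f' := g' (z + t • v)) (by simpa using h)
    have e : (fun u : ℝ => g (z + t • v + (u - t) • v)) = fun u : ℝ => g (z + u • v) := by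
      funext u
      rw [add_assoc, ← add_smul, add_sub_cancel]
    rwa [e] at h2
  have hL : HasDerivAt (fun t : ℝ => ∫ z, g (z + t • v) ∂(gvec n)) (∫ z, g' z ∂(gvec n)) 0 := by
    have := (hasDerivAt_integral_of_dominated_loc_of_deriv_le (μ := gvec n)
      (F := fun (t : ℝ) z => g (z + t • v)) (F' := fun t z => g' (z + t • v)) (x₀ := (0:ℝ))
      (s := Set.univ) (bound := fun _ => C) univ_mem
      (Eventually.of_forall fun t => by
        exact (hg.comp (by fun_prop)).aestronglyMeasurable)
      (Integrable.of_bound (C := C) (hg.comp (by fun_prop)).aestronglyMeasurable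
        (ae_of_all _ fun z => hC _))
      (hg'.comp (by fun_prop)).aestronglyMeasurable
      (ae_of_all _ fun z t _ => hC' _) (integrable_const _)
      (ae_of_all _ fun z t _ => hd2 z t)).2
    simpa using this
  set l : (Fin n → ℝ) → ℝ := fun z => ∑ i, v i * z i with hl
  set q : ℝ := ∑ i, v i ^ 2 / 2 with hq
  have hq0 : 0 ≤ q := Finset.sum_nonneg fun i _ => by positivity
  have hlm : Measurable l := by fun_prop
  have hs : ∀ t : ℝ, ∫ z, g (z + t • v) ∂(gvec n)
      = ∫ z, Real.exp (t * l z - t ^ 2 * q) * g z ∂(gvec n) := by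
    intro t
    rw [gvec_shift_integral _ _ hg]
    congr 1; ext z; congr 2
    simp only [hl, hq, Finset.mul_sum, Pi.smul_apply, smul_eq_mul]
    congr 1 <;> exact Finset.sum_congr rfl fun i _ => by ring
  have hR : HasDerivAt (fun t : ℝ => ∫ z, Real.exp (t * l z - t ^ 2 * q) * g z ∂(gvec n))
      (∫ z, l z * g z ∂(gvec n)) 0 := by
    have hexp : ∀ c : ℝ, Integrable (fun z => Real.exp (c * l z)) (gvec n) := by
      intro c
      have := gvec_exp_integrable (c • v) 0
      refine this.congr (ae_of_all _ fun z => ?_)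
      simp [hl, Finset.mul_sum, mul_assoc]
    have := (hasDerivAt_integral_of_dominated_loc_of_deriv_le (μ := gvec n)
      (F := fun (t : ℝ) z => Real.exp (t * l z - t ^ 2 * q) * g z)
      (F' := fun t z => Real.exp (t * l z - t ^ 2 * q) * (l z - 2 * t * q) * g z) (x₀ := (0:ℝ))
      (s := Metric.ball 0 1)
      (bound := fun z => (1 + 2 * q) * C * (Real.exp (2 * l z) + Real.exp ((-2) * l z)))
      (Metric.ball_mem_nhds _ one_pos)
      (Eventually.of_forall fun t => by
        exact Measurable.aestronglyMeasurable (by fun_prop))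
      (Integrable.of_bound (C := C) (Measurable.aestronglyMeasurable (by fun_prop))
        (ae_of_all _ fun z => by simpa using hC z))
      (Measurable.aestronglyMeasurable (by fun_prop))
      (ae_of_all _ fun z t ht => ?_) (((hexp _).add (hexp _)).const_mul _)
      (ae_of_all _ fun z t _ => ?_)).2
    · simpa using this
    · rw [Metric.mem_ball, dist_zero_right, norm_eq_abs] at ht
      have hC0 : 0 ≤ C := (abs_nonneg _).trans (hC z)
      rw [norm_mul, norm_mul, norm_eq_abs, norm_eq_abs, norm_eq_abs, Real.abs_exp]
      have a1 : Real.exp (t * l z - t ^ 2 * q) ≤ Real.exp |l z| := by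
        apply Real.exp_le_exp.mpr
        have : t * l z ≤ |l z| := by
          calc t * l z ≤ |t * l z| := le_abs_self _
            _ = |t| * |l z| := abs_mul _ _
            _ ≤ 1 * |l z| := by gcongr
            _ = _ := one_mul _
        have : 0 ≤ t ^ 2 * q := by positivity
        linarith
      have a2 : |l z - 2 * t * q| ≤ (1 + 2 * q) * Real.exp |l z| := by
        have b1 : |2 * t * q| ≤ 2 * q := by
          rw [abs_mul, abs_mul, abs_of_nonneg hq0, abs_two]; nlinarith
        have b2 := abs_sub (l z) (2 * t * q)
        have b3 := Real.add_one_le_exp |l z|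
        have b4 : 1 ≤ Real.exp |l z| := Real.one_le_exp (abs_nonneg _)
        nlinarith
      have a3 : Real.exp |l z| * Real.exp |l z| ≤ Real.exp (2 * l z) + Real.exp ((-2) * l z) := by
        rw [← Real.exp_add]
        have h3 := Real.exp_pos (2 * l z)
        have h4 := Real.exp_pos ((-2) * l z)
        rcases abs_cases (l z) with ⟨h, _⟩ | ⟨h, _⟩ <;> rw [h]
        · rw [← two_mul]; linarith
        · rw [show -l z + -l z = (-2) * l z by ring]; linarith
      calc _ ≤ Real.exp |l z| * ((1 + 2 * q) * Real.exp |l z|) * C := by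
            gcongr
            exact hC z
        _ = (1 + 2 * q) * C * (Real.exp |l z| * Real.exp |l z|) := by ring
        _ ≤ _ := by gcongr
    · apply HasDerivAt.mul_const
      apply HasDerivAt.exp
      have h1 := (hasDerivAt_id t).mul_const (l z)
      have h2 := ((hasDerivAt_id t).pow 2).mul_const q
      refine (h1.sub h2).congr_deriv ?_
      simp
  simp_rw [hs] at hL
  exact hR.unique hL

set_option linter.unusedVariables false
set_option linter.unusedSectionVars false

/-- Jensen: lower bound on a log-Laplace transform. -/
lemma log_laplace_lower {S : Type*} [MeasurableSpace S] (κ : Measure S) [IsProbabilityMeasure κ]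
    (V B : S → ℝ) (hV : Measurable V) (hB : Measurable B) (C M t : ℝ)
    (hVC : ∀ᵐ x ∂κ, |V x| ≤ C) (hBM : ∀ᵐ x ∂κ, |B x| ≤ M) :
    t * ∫ x, V x ∂κ - t ^ 2 * M ≤ Real.log (∫ x, Real.exp (t * V x + t ^ 2 * B x) ∂κ) := by
  have iV : Integrable V κ := Integrable.of_bound hV.aestronglyMeasurable C hVC
  have iB : Integrable B κ := Integrable.of_bound hB.aestronglyMeasurable M hBM
  have iL : Integrable (fun x => t * V x + t ^ 2 * B x) κ := (iV.const_mul t).add (iB.const_mul _)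
  have iE : Integrable (fun x => Real.exp (t * V x + t ^ 2 * B x)) κ := by
    refine Integrable.of_bound (Measurable.aestronglyMeasurable (by fun_prop))
      (Real.exp (|t| * C + t ^ 2 * M)) ?_
    filter_upwards [hVC, hBM] with x h1 h2
    rw [norm_eq_abs, Real.abs_exp]
    apply Real.exp_le_exp.mpr
    have e1 : t * V x ≤ |t| * C := (le_abs_self _).trans (by rw [abs_mul]; gcongr)
    have e2 : t ^ 2 * B x ≤ t ^ 2 * M := by gcongr; exact (le_abs_self _).trans h2
    linarith
  have hJ := (convexOn_exp).map_integral_le (μ := κ) (f := fun x => t * V x + t ^ 2 * B x)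
    Real.continuous_exp.continuousOn isClosed_univ (by simp) iL iE
  have h1 : ∫ x, (t * V x + t ^ 2 * B x) ∂κ ≤ Real.log (∫ x, Real.exp (t * V x + t ^ 2 * B x) ∂κ) := by
    rw [Real.le_log_iff_exp_le ((Real.exp_pos _).trans_le hJ)]
    exact hJ
  rw [integral_add (iV.const_mul t) (iB.const_mul _), integral_const_mul, integral_const_mul] at h1
  have h2 : -M ≤ ∫ x, B x ∂κ := by
    have := integral_mono_ae (integrable_const (-M)) iB
      (hBM.mono fun x hx => (abs_le.mp hx).1)
    simpa using this
  nlinarith [sq_nonneg t]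

/-- Upper bound on the mean absolute deviation through log-Laplace transforms. -/
lemma abs_dev_upper {S : Type*} [MeasurableSpace S] (κ : Measure S) [IsProbabilityMeasure κ]
    (V B : S → ℝ) (hV : Measurable V) (hB : Measurable B) (C M δ c e : ℝ)
    (hVC : ∀ᵐ x ∂κ, |V x| ≤ C) (hBM : ∀ᵐ x ∂κ, |B x| ≤ M)
    (h1 : Real.log (∫ x, Real.exp (δ * V x + δ ^ 2 * B x) ∂κ) - δ * c ≤ e)
    (h2 : Real.log (∫ x, Real.exp ((-δ) * V x + (-δ) ^ 2 * B x) ∂κ) + δ * c ≤ e) :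
    δ * ∫ x, |V x - c| ∂κ ≤ Real.log 2 + δ ^ 2 * M + e := by
  have iE : ∀ t : ℝ, Integrable (fun x => Real.exp (t * V x + t ^ 2 * B x)) κ := by
    intro t
    refine Integrable.of_bound (Measurable.aestronglyMeasurable (by fun_prop))
      (Real.exp (|t| * C + t ^ 2 * M)) ?_
    filter_upwards [hVC, hBM] with x h1 h2
    rw [norm_eq_abs, Real.abs_exp]
    apply Real.exp_le_exp.mpr
    have e1 : t * V x ≤ |t| * C := (le_abs_self _).trans (by rw [abs_mul]; gcongr)
    have e2 : t ^ 2 * B x ≤ t ^ 2 * M := by gcongr; exact (le_abs_self _).trans h2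
    linarith
  have mabs : Measurable (fun x => |V x - c|) := (hV.sub_const c).abs
  have iA : Integrable (fun x => |V x - c|) κ := by
    refine Integrable.of_bound mabs.aestronglyMeasurable (C + |c|) ?_
    filter_upwards [hVC] with x h1
    rw [norm_eq_abs, abs_abs]
    exact (abs_sub _ _).trans (by linarith)
  have iX : Integrable (fun x => Real.exp (δ * |V x - c|)) κ := by
    refine Integrable.of_bound (Measurable.aestronglyMeasurable (by fun_prop))
      (Real.exp (|δ| * (C + |c|))) ?_
    filter_upwards [hVC] with x h1
    rw [norm_eq_abs, Real.abs_exp]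
    apply Real.exp_le_exp.mpr
    calc δ * |V x - c| ≤ |δ| * |V x - c| := by gcongr; exact le_abs_self _
      _ ≤ _ := by gcongr; exact (abs_sub _ _).trans (by linarith)
  have hJ := (convexOn_exp).map_integral_le (μ := κ) (f := fun x => δ * |V x - c|)
    Real.continuous_exp.continuousOn isClosed_univ (by simp) (iA.const_mul δ) iX
  rw [integral_const_mul] at hJ
  have hpos : ∀ t : ℝ, 0 < ∫ x, Real.exp (t * V x + t ^ 2 * B x) ∂κ := fun t =>
    integral_exp_pos (iE t)
  have h1' : ∫ x, Real.exp (δ * V x + δ ^ 2 * B x) ∂κ ≤ Real.exp (e + δ * c) := by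
    rw [← Real.log_le_iff_le_exp (hpos δ)]; linarith
  have h2' : ∫ x, Real.exp ((-δ) * V x + (-δ) ^ 2 * B x) ∂κ ≤ Real.exp (e - δ * c) := by
    rw [← Real.log_le_iff_le_exp (hpos (-δ))]; linarith
  have hb : ∫ x, Real.exp (δ * |V x - c|) ∂κ ≤
      ∫ x, (Real.exp (δ ^ 2 * M - δ * c) * Real.exp (δ * V x + δ ^ 2 * B x)
        + Real.exp (δ ^ 2 * M + δ * c) * Real.exp ((-δ) * V x + (-δ) ^ 2 * B x)) ∂κ := by
    refine integral_mono_ae iX (((iE δ).const_mul _).add ((iE (-δ)).const_mul _)) ?_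
    filter_upwards [hBM] with x hx
    simp only [← Real.exp_add]
    have hx' := mul_le_mul_of_nonneg_left ((abs_le.mp hx).1) (sq_nonneg δ)
    have p1 := Real.exp_pos (δ ^ 2 * M - δ * c + (δ * V x + δ ^ 2 * B x))
    have p2 := Real.exp_pos (δ ^ 2 * M + δ * c + (-δ * V x + (-δ) ^ 2 * B x))
    rcases abs_cases (V x - c) with ⟨h, _⟩ | ⟨h, _⟩ <;> rw [h]
    · have : Real.exp (δ * (V x - c)) ≤ Real.exp (δ ^ 2 * M - δ * c + (δ * V x + δ ^ 2 * B x)) := by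
        apply Real.exp_le_exp.mpr; linarith
      linarith
    · have : Real.exp (δ * -(V x - c)) ≤
          Real.exp (δ ^ 2 * M + δ * c + (-δ * V x + (-δ) ^ 2 * B x)) := by
        apply Real.exp_le_exp.mpr; rw [neg_sq]; linarith
      linarith
  rw [integral_add ((iE δ).const_mul _) ((iE (-δ)).const_mul _), integral_const_mul,
    integral_const_mul] at hb
  have hfin : Real.exp (δ * ∫ x, |V x - c| ∂κ) ≤ Real.exp (Real.log 2 + δ ^ 2 * M + e) := by
    refine hJ.trans (hb.trans ?_)
    calc _ ≤ Real.exp (δ ^ 2 * M - δ * c) * Real.exp (e + δ * c)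
          + Real.exp (δ ^ 2 * M + δ * c) * Real.exp (e - δ * c) := by gcongr
      _ = _ := by
        rw [← Real.exp_add, ← Real.exp_add, show Real.log 2 + δ ^ 2 * M + e
          = Real.log 2 + (δ ^ 2 * M + e) by ring, Real.exp_add (Real.log 2), Real.exp_log two_pos]
        ring_nf
  exact Real.exp_le_exp.mp hfin

/-- Bundled hypotheses for a fixed dimension. -/
structure Mdl {𝒴 : Type*} [MeasurableSpace 𝒴] (n : ℕ) (K : ℝ) (P : Measure (Fin n → ℝ))
    (ν : Measure ((Fin n → ℝ) × 𝒴)) (W : (Fin n → ℝ) → 𝒴 → ℝ) : Prop where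
  Kpos : 0 < K
  Wmeas : Measurable fun p : (Fin n → ℝ) × 𝒴 => W p.1 p.2
  Wpos : ∀ x y, 0 ≤ W x y
  marg : ν.map Prod.fst = P
  supp : ∀ᵐ x ∂P, ∀ i, |x i| ≤ K
  logZint : Integrable (fun y => Real.log (∫ x, W x y ∂P)) (ν.map Prod.snd)
  cond : ∀ (f : (Fin n → ℝ) × 𝒴 → ℝ), Measurable f → (∃ C : ℝ, ∀ p, |f p| ≤ C) →
      ∫ p, f p ∂ν
        = ∫ y, (∫ x, f (x, y) * W x y ∂P) / (∫ x, W x y ∂P) ∂(ν.map Prod.snd)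

/-- Non-degenerate disorder. -/
structure Good {𝒴 : Type*} {n : ℕ} (K : ℝ) (P : Measure (Fin n → ℝ))
    (W : (Fin n → ℝ) → 𝒴 → ℝ) (X : Fin n → ℝ) (y : 𝒴) : Prop where
  bd : ∀ i, |X i| ≤ K
  int : Integrable (fun x => W x y) P
  pos : 0 < ∫ x, W x y ∂P

/-- The Gibbs measure. -/
def gm {𝒴 : Type*} [MeasurableSpace 𝒴] (n : ℕ) (P : Measure (Fin n → ℝ))
    (W : (Fin n → ℝ) → 𝒴 → ℝ) (sn a : ℝ)
    (ω : ((Fin n → ℝ) × 𝒴) × (Fin n → ℝ)) : Measure (Fin n → ℝ) :=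
  P.withDensity fun x => ENNReal.ofReal
    (W x ω.1.2 * Real.exp (hPert n sn a ω.1.1 ω.2 x) / Zpert n P W sn a ω)

/-- First order part of the Hamiltonian. -/
def hA (n : ℕ) (sn : ℝ) (z x : Fin n → ℝ) : ℝ := Real.sqrt sn * ∑ i, z i * x i

/-- Second order part of the Hamiltonian. -/
def hB (n : ℕ) (sn : ℝ) (X x : Fin n → ℝ) : ℝ := sn * ∑ i, (x i * X i - x i ^ 2 / 2)

/-- The derivative of the Hamiltonian in `a`, normalised. -/
def hU (n : ℕ) (sn a : ℝ) (X z x : Fin n → ℝ) : ℝ :=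
  (hA n sn z x + 2 * a * hB n sn X x) / (n * sn)

lemma hPert_eq (n : ℕ) (sn a : ℝ) (X z x : Fin n → ℝ) :
    hPert n sn a X z x = a * hA n sn z x + a ^ 2 * hB n sn X x := by
  unfold hPert hA hB
  simp only [Finset.mul_sum, ← Finset.sum_add_distrib]
  exact Finset.sum_congr rfl fun i _ => by ring

lemma hA_bd {n : ℕ} {sn K : ℝ} (hs : sn ∈ Set.Ioc (0:ℝ) 1) (hK : 0 < K) (z x : Fin n → ℝ)
    (hx : ∀ i, |x i| ≤ K) : |hA n sn z x| ≤ K * ∑ i, |z i| := by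
  unfold hA
  rw [abs_mul, abs_of_nonneg (Real.sqrt_nonneg _)]
  have h1 : Real.sqrt sn ≤ 1 := Real.sqrt_le_one.mpr hs.2
  have h2 : |∑ i, z i * x i| ≤ ∑ i, |z i| * K :=
    (Finset.abs_sum_le_sum_abs _ _).trans
      (Finset.sum_le_sum fun i _ => by rw [abs_mul]; gcongr; exact hx i)
  rw [← Finset.sum_mul] at h2
  calc _ ≤ 1 * ((∑ i, |z i|) * K) := by gcongr
    _ = _ := by ring

lemma hB_bd {n : ℕ} {sn K : ℝ} (hs : sn ∈ Set.Ioc (0:ℝ) 1) (hK : 0 < K) (X x : Fin n → ℝ)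
    (hX : ∀ i, |X i| ≤ K) (hx : ∀ i, |x i| ≤ K) :
    |hB n sn X x| ≤ n * sn * (3 / 2 * K ^ 2) := by
  unfold hB
  rw [abs_mul, abs_of_pos hs.1]
  have h2 : |∑ i, (x i * X i - x i ^ 2 / 2)| ≤ ∑ i : Fin n, (3 / 2 * K ^ 2) := by
    refine (Finset.abs_sum_le_sum_abs _ _).trans (Finset.sum_le_sum fun i _ => ?_)
    refine (abs_sub _ _).trans ?_
    rw [abs_mul, abs_div, abs_two, abs_pow]
    have e1 : |x i| * |X i| ≤ K * K := mul_le_mul (hx i) (hX i) (abs_nonneg _) hK.le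
    have e2 : |x i| ^ 2 ≤ K ^ 2 := pow_le_pow_left₀ (abs_nonneg _) (hx i) 2
    nlinarith
  simp only [Finset.sum_const, Finset.card_univ, Fintype.card_fin, nsmul_eq_mul] at h2
  calc _ ≤ sn * (n * (3 / 2 * K ^ 2)) := by gcongr; exact hs.1.le
    _ = _ := by ring

lemma hPert_bd {n : ℕ} {sn K : ℝ} (a : ℝ) (hs : sn ∈ Set.Ioc (0:ℝ) 1) (hK : 0 < K)
    (X z x : Fin n → ℝ) (hX : ∀ i, |X i| ≤ K) (hx : ∀ i, |x i| ≤ K) :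
    |hPert n sn a X z x| ≤ |a| * (K * ∑ i, |z i|) + a ^ 2 * (n * sn * (3 / 2 * K ^ 2)) := by
  rw [hPert_eq]
  refine (abs_add_le _ _).trans ?_
  rw [abs_mul, abs_mul, abs_of_nonneg (sq_nonneg a)]
  gcongr
  · exact hA_bd hs hK z x hx
  · exact hB_bd hs hK X x hX hx

@[fun_prop]
lemma hPert_meas (n : ℕ) (sn a : ℝ) :
    Measurable fun p : (Fin n → ℝ) × (Fin n → ℝ) × (Fin n → ℝ) => hPert n sn a p.1 p.2.1 p.2.2 := by
  unfold hPert; fun_prop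

lemma hU_meas (n : ℕ) (sn a : ℝ) :
    Measurable fun p : (Fin n → ℝ) × (Fin n → ℝ) × (Fin n → ℝ) => hU n sn a p.1 p.2.1 p.2.2 := by
  unfold hU hA hB; fun_prop

section
variable {𝒴 : Type*} [MeasurableSpace 𝒴] {n : ℕ} {K : ℝ} {P : Measure (Fin n → ℝ)}
  [IsProbabilityMeasure P] {ν : Measure ((Fin n → ℝ) × 𝒴)} [IsProbabilityMeasure ν]
  {W : (Fin n → ℝ) → 𝒴 → ℝ} {sn : ℝ}

lemma Mdl.wt_meas (M : Mdl n K P ν W) (sn a : ℝ) :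
    Measurable fun p : (((Fin n → ℝ) × 𝒴) × (Fin n → ℝ)) × (Fin n → ℝ) =>
      W p.2 p.1.1.2 * Real.exp (hPert n sn a p.1.1.1 p.1.2 p.2) := by
  have h1 : Measurable fun p : (((Fin n → ℝ) × 𝒴) × (Fin n → ℝ)) × (Fin n → ℝ) =>
      W p.2 p.1.1.2 :=
    M.Wmeas.comp (g := fun p : (Fin n → ℝ) × 𝒴 => W p.1 p.2)
      (f := fun p : (((Fin n → ℝ) × 𝒴) × (Fin n → ℝ)) × (Fin n → ℝ) => (p.2, p.1.1.2)) (by fun_prop)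
  have h2 : Measurable fun p : (((Fin n → ℝ) × 𝒴) × (Fin n → ℝ)) × (Fin n → ℝ) =>
      hPert n sn a p.1.1.1 p.1.2 p.2 :=
    (hPert_meas n sn a).comp
      (f := fun p : (((Fin n → ℝ) × 𝒴) × (Fin n → ℝ)) × (Fin n → ℝ) => (p.1.1.1, p.1.2, p.2))
      (by fun_prop)
  exact h1.mul h2.exp

lemma Mdl.wt_meas_x (M : Mdl n K P ν W) (sn a : ℝ) (ω : ((Fin n → ℝ) × 𝒴) × (Fin n → ℝ)) :
    Measurable fun x => W x ω.1.2 * Real.exp (hPert n sn a ω.1.1 ω.2 x) :=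
  (M.wt_meas sn a).comp (f := fun x => (ω, x)) (by fun_prop)

lemma Mdl.W_meas_x (M : Mdl n K P ν W) (y : 𝒴) : Measurable fun x => W x y :=
  M.Wmeas.comp (f := fun x => (x, y)) (by fun_prop)

lemma Mdl.Zpert_meas (M : Mdl n K P ν W) (sn a : ℝ) : Measurable (Zpert n P W sn a) := by
  have := (M.wt_meas sn a).stronglyMeasurable.integral_prod_right' (ν := P)
  exact this.measurable

lemma Mdl.Z0_meas (M : Mdl n K P ν W) : Measurable (fun y => ∫ x, W x y ∂P) :=
  (M.Wmeas.stronglyMeasurable.integral_prod_left' (μ := P)).measurable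

lemma Mdl.Zpert_nonneg (M : Mdl n K P ν W) (sn a : ℝ) (ω) : 0 ≤ Zpert n P W sn a ω :=
  integral_nonneg fun x => mul_nonneg (M.Wpos _ _) (Real.exp_pos _).le

lemma Mdl.gibbs_eq (M : Mdl n K P ν W) (sn a : ℝ) (ω) (f : (Fin n → ℝ) → ℝ) :
    gibbsPert n P W sn a ω f = ∫ x, f x ∂(gm n P W sn a ω) := by
  unfold gibbsPert gm
  rw [integral_withDensity_eq_integral_toReal_smul
    ((M.wt_meas_x sn a ω).div_const _).ennreal_ofReal (by simp), ← integral_div]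
  congr 1; ext x
  rw [ENNReal.toReal_ofReal (div_nonneg (mul_nonneg (M.Wpos _ _) (Real.exp_pos _).le)
    (M.Zpert_nonneg sn a ω)), smul_eq_mul]
  ring

lemma Mdl.gibbs_meas (M : Mdl n K P ν W) (sn a : ℝ)
    {f : (((Fin n → ℝ) × 𝒴) × (Fin n → ℝ)) → (Fin n → ℝ) → ℝ}
    (hf : Measurable fun p : (((Fin n → ℝ) × 𝒴) × (Fin n → ℝ)) × (Fin n → ℝ) => f p.1 p.2) :
    Measurable fun ω => gibbsPert n P W sn a ω (f ω) := by
  unfold gibbsPert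
  have := ((hf.mul (M.wt_meas sn a)).stronglyMeasurable.integral_prod_right' (ν := P)).measurable
  exact this.div (M.Zpert_meas sn a)

lemma Mdl.good_ae (M : Mdl n K P ν W) : ∀ᵐ p ∂ν, Good K P W p.1 p.2 := by
  have h0 : ∀ᵐ y ∂(ν.map Prod.snd), (∫ x, W x y ∂P) ≠ 0 := by
    have h := M.cond (fun _ => 1) measurable_const ⟨1, by simp⟩
    simp only [one_mul, integral_const, probReal_univ, smul_eq_mul, mul_one] at h
    have hms : MeasurableSet {y : 𝒴 | (∫ x, W x y ∂P) ≠ 0} :=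
      (M.Z0_meas (measurableSet_singleton (0:ℝ))).compl
    have : IsProbabilityMeasure (ν.map Prod.snd) :=
      Measure.isProbabilityMeasure_map measurable_snd.aemeasurable
    have e : ∀ y, (∫ x, W x y ∂P) / (∫ x, W x y ∂P)
        = Set.indicator {y : 𝒴 | (∫ x, W x y ∂P) ≠ 0} (fun _ => (1:ℝ)) y := by
      intro y
      by_cases hy : (∫ x, W x y ∂P) = 0
      · simp [hy]
      · simp [hy]
    simp_rw [e] at h
    rw [integral_indicator_const _ hms, measureReal_def, smul_eq_mul, mul_one] at h
    have h2 : (ν.map Prod.snd) {y : 𝒴 | (∫ x, W x y ∂P) ≠ 0} = 1 := by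
      rw [← ENNReal.toReal_eq_one_iff]; exact h.symm
    exact (prob_compl_eq_zero_iff hms).mpr h2
  have h1 : ∀ᵐ p ∂ν, (∫ x, W x p.2 ∂P) ≠ 0 := ae_of_ae_map measurable_snd.aemeasurable h0
  have h2 : ∀ᵐ p ∂ν, ∀ i, |p.1 i| ≤ K := by
    have := M.supp
    rw [← M.marg] at this
    exact ae_of_ae_map measurable_fst.aemeasurable this
  filter_upwards [h1, h2] with p hp1 hp2
  refine ⟨hp2, ?_, ?_⟩
  · by_contra h
    exact hp1 (integral_undef h)
  · exact lt_of_le_of_ne (integral_nonneg fun x => M.Wpos _ _) (Ne.symm hp1)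

instance : IsProbabilityMeasure (pertSpace n ν) := by unfold pertSpace; infer_instance

lemma Mdl.good_ae' (M : Mdl n K P ν W) : ∀ᵐ ω ∂(pertSpace n ν), Good K P W ω.1.1 ω.1.2 := by
  unfold pertSpace
  exact Measure.quasiMeasurePreserving_fst.ae M.good_ae

lemma Mdl.wt_int (M : Mdl n K P ν W) (hs : sn ∈ Set.Ioc (0:ℝ) 1) (a : ℝ)
    {X : Fin n → ℝ} {y : 𝒴} (G : Good K P W X y) (z : Fin n → ℝ) :
    Integrable (fun x => W x y * Real.exp (hPert n sn a X z x)) P := by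
  have hm : Measurable fun x => Real.exp (hPert n sn a X z x) := by
    unfold hPert; fun_prop
  refine G.int.mul_bdd hm.aestronglyMeasurable (c := Real.exp (|a| * (K * ∑ i, |z i|) + a ^ 2 * (n * sn * (3 / 2 * K ^ 2)))) ?_
  filter_upwards [M.supp] with x hx
  rw [norm_eq_abs, Real.abs_exp]
  exact Real.exp_le_exp.mpr ((le_abs_self _).trans (hPert_bd a hs M.Kpos X z x G.bd hx))

lemma Mdl.Z_bounds (M : Mdl n K P ν W) (hs : sn ∈ Set.Ioc (0:ℝ) 1) (a : ℝ)
    {X : Fin n → ℝ} {y : 𝒴} (G : Good K P W X y) (z : Fin n → ℝ) :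
    Real.exp (-(|a| * (K * ∑ i, |z i|) + a ^ 2 * (n * sn * (3 / 2 * K ^ 2)))) * ∫ x, W x y ∂P
      ≤ Zpert n P W sn a ((X, y), z) ∧
    Zpert n P W sn a ((X, y), z) ≤
    Real.exp (|a| * (K * ∑ i, |z i|) + a ^ 2 * (n * sn * (3 / 2 * K ^ 2))) * ∫ x, W x y ∂P := by
  unfold Zpert
  rw [← integral_const_mul, ← integral_const_mul]
  constructor
  · refine integral_mono_ae (G.int.const_mul _) (M.wt_int hs a G z) ?_
    filter_upwards [M.supp] with x hx
    rw [mul_comm]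
    refine mul_le_mul_of_nonneg_left (Real.exp_le_exp.mpr ?_) (M.Wpos _ _)
    exact (abs_le.mp (hPert_bd a hs M.Kpos X z x G.bd hx)).1
  · refine integral_mono_ae (M.wt_int hs a G z) (G.int.const_mul _) ?_
    filter_upwards [M.supp] with x hx
    rw [mul_comm (Real.exp _) (W x y)]
    refine mul_le_mul_of_nonneg_left (Real.exp_le_exp.mpr ?_) (M.Wpos _ _)
    exact (abs_le.mp (hPert_bd a hs M.Kpos X z x G.bd hx)).2

lemma Mdl.Z_pos (M : Mdl n K P ν W) (hs : sn ∈ Set.Ioc (0:ℝ) 1) (a : ℝ)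
    {X : Fin n → ℝ} {y : 𝒴} (G : Good K P W X y) (z : Fin n → ℝ) :
    0 < Zpert n P W sn a ((X, y), z) :=
  lt_of_lt_of_le (mul_pos (Real.exp_pos _) G.pos) (M.Z_bounds hs a G z).1

lemma Mdl.logZ_bd (M : Mdl n K P ν W) (hs : sn ∈ Set.Ioc (0:ℝ) 1) (a : ℝ)
    {X : Fin n → ℝ} {y : 𝒴} (G : Good K P W X y) (z : Fin n → ℝ) :
    |Real.log (Zpert n P W sn a ((X, y), z))| ≤ |Real.log (∫ x, W x y ∂P)|
      + (|a| * (K * ∑ i, |z i|) + a ^ 2 * (n * sn * (3 / 2 * K ^ 2))) := by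
  obtain ⟨h1, h2⟩ := M.Z_bounds hs a G z
  have h1' := Real.log_le_log (mul_pos (Real.exp_pos _) G.pos) h1
  have h2' := Real.log_le_log (M.Z_pos hs a G z) h2
  rw [Real.log_mul (Real.exp_pos _).ne' G.pos.ne', Real.log_exp] at h1' h2'
  have h3 := abs_le.mp (le_refl |Real.log (∫ x, W x y ∂P)|)
  rw [abs_le]
  constructor <;> linarith

lemma Mdl.gm_prob (M : Mdl n K P ν W) (hs : sn ∈ Set.Ioc (0:ℝ) 1) (a : ℝ)
    {X : Fin n → ℝ} {y : 𝒴} (G : Good K P W X y) (z : Fin n → ℝ) :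
    IsProbabilityMeasure (gm n P W sn a ((X, y), z)) := by
  constructor
  unfold gm
  rw [withDensity_apply _ MeasurableSet.univ, Measure.restrict_univ,
    ← ofReal_integral_eq_lintegral_ofReal ((M.wt_int hs a G z).div_const _)
      (ae_of_all _ fun x => div_nonneg (mul_nonneg (M.Wpos _ _) (Real.exp_pos _).le)
        (M.Zpert_nonneg sn a _)), integral_div]
  have := (M.Z_pos hs a G z).ne'
  rw [show (∫ x, W x ((X, y), z).1.2 * Real.exp (hPert n sn a ((X, y), z).1.1 ((X, y), z).2 x) ∂P)
    = Zpert n P W sn a ((X, y), z) from rfl, div_self this, ENNReal.ofReal_one]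

lemma Mdl.gm_supp (M : Mdl n K P ν W) (sn a : ℝ) (ω) :
    ∀ᵐ x ∂(gm n P W sn a ω), ∀ i, |x i| ≤ K :=
  (withDensity_absolutelyContinuous _ _).ae_le M.supp

lemma Mdl.Z_ratio (M : Mdl n K P ν W) (a b : ℝ) (ω) :
    ∫ x, Real.exp (hPert n sn b ω.1.1 ω.2 x - hPert n sn a ω.1.1 ω.2 x) ∂(gm n P W sn a ω)
      = Zpert n P W sn b ω / Zpert n P W sn a ω := by
  rw [← M.gibbs_eq]
  unfold gibbsPert
  congr 1
  unfold Zpert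
  congr 1; ext x
  rw [mul_left_comm, ← Real.exp_add, sub_add_cancel]

lemma Mdl.U_bd (M : Mdl n K P ν W) (hs : sn ∈ Set.Ioc (0:ℝ) 1) (hn : 0 < n) (a : ℝ)
    (X z x : Fin n → ℝ) (hX : ∀ i, |X i| ≤ K) (hx : ∀ i, |x i| ≤ K) :
    |hU n sn a X z x| ≤ (K * ∑ i, |z i|) / (n * sn) + 3 * |a| * K ^ 2 := by
  have hN : 0 < (n:ℝ) * sn := mul_pos (by exact_mod_cast hn) hs.1
  unfold hU
  rw [abs_div, abs_of_pos hN, div_add' _ _ _ hN.ne']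
  gcongr
  refine (abs_add_le _ _).trans ?_
  have h1 := hA_bd hs M.Kpos z x hx
  have h2 := hB_bd hs M.Kpos X x hX hx
  rw [abs_mul, abs_mul, abs_two]
  have := abs_nonneg a
  nlinarith [mul_le_mul_of_nonneg_left h2 this]

lemma Mdl.V_eq (hs : sn ∈ Set.Ioc (0:ℝ) 1) (hn : 0 < n) (a : ℝ) (X z x : Fin n → ℝ) :
    hA n sn z x + 2 * a * hB n sn X x = n * sn * hU n sn a X z x := by
  have hN : 0 < (n:ℝ) * sn := mul_pos (by exact_mod_cast hn) hs.1
  unfold hU; rw [mul_div_cancel₀ _ hN.ne']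

lemma Mdl.phi_diff (M : Mdl n K P ν W) (hs : sn ∈ Set.Ioc (0:ℝ) 1) (hn : 0 < n) (a t : ℝ)
    {X : Fin n → ℝ} {y : 𝒴} (G : Good K P W X y) (z : Fin n → ℝ) :
    (n * sn) * (phiPert n P W sn (a + t) ((X, y), z) - phiPert n P W sn a ((X, y), z))
      = Real.log (∫ x, Real.exp (t * (n * sn * hU n sn a X z x) + t ^ 2 * hB n sn X x)
          ∂(gm n P W sn a ((X, y), z))) := by
  have hN : 0 < (n:ℝ) * sn := mul_pos (by exact_mod_cast hn) hs.1
  have e : ∀ x, t * (n * sn * hU n sn a X z x) + t ^ 2 * hB n sn X x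
      = hPert n sn (a + t) X z x - hPert n sn a X z x := by
    intro x
    rw [← Mdl.V_eq hs hn, hPert_eq, hPert_eq]; ring
  simp_rw [e]
  have h := M.Z_ratio (sn := sn) a (a + t) ((X, y), z)
  simp only at h
  rw [h, Real.log_div (M.Z_pos hs _ G z).ne' (M.Z_pos hs _ G z).ne']
  unfold phiPert
  rw [← mul_sub, ← mul_assoc, mul_one_div_cancel hN.ne', one_mul]

lemma Mdl.phi_lower (M : Mdl n K P ν W) (hs : sn ∈ Set.Ioc (0:ℝ) 1) (hn : 0 < n) (a t : ℝ)
    {X : Fin n → ℝ} {y : 𝒴} (G : Good K P W X y) (z : Fin n → ℝ) :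
    t * gibbsPert n P W sn a ((X, y), z) (hU n sn a X z) - 3 / 2 * K ^ 2 * t ^ 2
      ≤ phiPert n P W sn (a + t) ((X, y), z) - phiPert n P W sn a ((X, y), z) := by
  have hN : 0 < (n:ℝ) * sn := mul_pos (by exact_mod_cast hn) hs.1
  have := M.gm_prob hs a G z
  have mU : Measurable (hU n sn a X z) := by unfold hU hA hB; fun_prop
  have mB : Measurable (hB n sn X) := by unfold hB; fun_prop
  have h := log_laplace_lower (gm n P W sn a ((X, y), z)) (fun x => n * sn * hU n sn a X z x)
    (hB n sn X) (mU.const_mul _) mB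
    (n * sn * ((K * ∑ i, |z i|) / (n * sn) + 3 * |a| * K ^ 2)) (n * sn * (3 / 2 * K ^ 2)) t
    ((M.gm_supp sn a _).mono fun x hx => by
      rw [abs_mul, abs_of_pos hN]; gcongr; exact M.U_bd hs hn a X z x G.bd hx)
    ((M.gm_supp sn a _).mono fun x hx => hB_bd hs M.Kpos X x G.bd hx)
  rw [← M.phi_diff hs hn a t G z, integral_const_mul, ← M.gibbs_eq] at h
  refine le_of_mul_le_mul_left ?_ hN
  refine le_trans (le_of_eq ?_) h
  ring

lemma Mdl.U_dev (M : Mdl n K P ν W) (hs : sn ∈ Set.Ioc (0:ℝ) 1) (hn : 0 < n) (a δ c e : ℝ)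
    {X : Fin n → ℝ} {y : 𝒴} (G : Good K P W X y) (z : Fin n → ℝ)
    (h1 : phiPert n P W sn (a + δ) ((X, y), z) - phiPert n P W sn a ((X, y), z) - δ * c ≤ e)
    (h2 : phiPert n P W sn (a - δ) ((X, y), z) - phiPert n P W sn a ((X, y), z) + δ * c ≤ e) :
    δ * gibbsPert n P W sn a ((X, y), z) (fun x => |hU n sn a X z x - c|)
      ≤ Real.log 2 / (n * sn) + 3 / 2 * K ^ 2 * δ ^ 2 + e := by
  have hN : 0 < (n:ℝ) * sn := mul_pos (by exact_mod_cast hn) hs.1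
  have := M.gm_prob hs a G z
  have mU : Measurable (hU n sn a X z) := by unfold hU hA hB; fun_prop
  have mB : Measurable (hB n sn X) := by unfold hB; fun_prop
  have h := abs_dev_upper (gm n P W sn a ((X, y), z)) (fun x => n * sn * hU n sn a X z x)
    (hB n sn X) (mU.const_mul _) mB
    (n * sn * ((K * ∑ i, |z i|) / (n * sn) + 3 * |a| * K ^ 2)) (n * sn * (3 / 2 * K ^ 2)) δ
    (n * sn * c) (n * sn * e)
    ((M.gm_supp sn a _).mono fun x hx => by
      rw [abs_mul, abs_of_pos hN]; gcongr; exact M.U_bd hs hn a X z x G.bd hx)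
    ((M.gm_supp sn a _).mono fun x hx => hB_bd hs M.Kpos X x G.bd hx)
    (by
      rw [← M.phi_diff hs hn a δ G z]
      nlinarith [mul_le_mul_of_nonneg_left h1 hN.le])
    (by
      rw [← M.phi_diff hs hn a (-δ) G z, ← sub_eq_add_neg]
      nlinarith [mul_le_mul_of_nonneg_left h2 hN.le])
  have e2 : ∀ x, |n * sn * hU n sn a X z x - n * sn * c| = n * sn * |hU n sn a X z x - c| := by
    intro x
    rw [← mul_sub, abs_mul, abs_of_pos hN]
  simp_rw [e2] at h
  rw [integral_const_mul, ← M.gibbs_eq] at h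
  refine le_of_mul_le_mul_left ?_ hN
  have e1 : (n * sn) * (Real.log 2 / (n * sn) + 3 / 2 * K ^ 2 * δ ^ 2 + e)
      = Real.log 2 + δ ^ 2 * (n * sn * (3 / 2 * K ^ 2)) + n * sn * e := by
    rw [mul_add, mul_add, mul_div_cancel₀ _ hN.ne']; ring
  rw [e1]
  refine le_trans (le_of_eq ?_) h
  ring

end

/-- Abstract Nishimori identity. -/
lemma nishi_abs {S T : Type*} [MeasurableSpace S] [MeasurableSpace T] (P : Measure S)
    [IsProbabilityMeasure P] (τ : Measure T) [IsProbabilityMeasure τ] (w : S → T → ℝ) (c : T → ℝ)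
    (hw : Measurable fun p : S × T => w p.1 p.2) (hc : Measurable c) (hw0 : ∀ x t, 0 ≤ w x t)
    (hc0 : ∀ t, 0 ≤ c t)
    (hprob : IsProbabilityMeasure
      ((P.prod τ).withDensity fun p => ENNReal.ofReal (w p.1 p.2 * c p.2)))
    (F : S → T → ℝ)
    (hF : Integrable (fun p : S × T => F p.1 p.2)
      ((P.prod τ).withDensity fun p => ENNReal.ofReal (w p.1 p.2 * c p.2)))
    (hG : Integrable (fun p : S × T => (∫ x, F x p.2 * w x p.2 ∂P) / ∫ x, w x p.2 ∂P)
      ((P.prod τ).withDensity fun p => ENNReal.ofReal (w p.1 p.2 * c p.2))) :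
    ∫ p, F p.1 p.2 ∂((P.prod τ).withDensity fun p => ENNReal.ofReal (w p.1 p.2 * c p.2))
      = ∫ p, (∫ x, F x p.2 * w x p.2 ∂P) / (∫ x, w x p.2 ∂P)
        ∂((P.prod τ).withDensity fun p => ENNReal.ofReal (w p.1 p.2 * c p.2)) := by
  have hm : Measurable fun p : S × T => ENNReal.ofReal (w p.1 p.2 * c p.2) :=
    (hw.mul (hc.comp measurable_snd)).ennreal_ofReal
  have hwc0 : ∀ p : S × T, 0 ≤ w p.1 p.2 * c p.2 := fun p => mul_nonneg (hw0 _ _) (hc0 _)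
  rw [integral_withDensity_eq_integral_toReal_smul hm (by simp),
    integral_withDensity_eq_integral_toReal_smul hm (by simp)]
  rw [integrable_withDensity_iff_integrable_smul' hm (by simp)] at hF hG
  have h1 : Integrable (fun p : S × T => w p.1 p.2 * c p.2) (P.prod τ) := by
    have : Integrable (fun _ : S × T => (1:ℝ))
      ((P.prod τ).withDensity fun p => ENNReal.ofReal (w p.1 p.2 * c p.2)) := integrable_const _
    rw [integrable_withDensity_iff_integrable_smul' hm (by simp)] at this
    refine this.congr (ae_of_all _ fun p => ?_)
    simp [ENNReal.toReal_ofReal (hwc0 p)]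
  simp_rw [ENNReal.toReal_ofReal (hwc0 _), smul_eq_mul] at hF hG ⊢
  rw [integral_prod_symm _ hF, integral_prod_symm _ hG]
  refine integral_congr_ae ?_
  filter_upwards [h1.prod_left_ae] with t ht
  by_cases hct : c t = 0
  · simp [hct]
  have hwi : Integrable (fun x => w x t) P := by
    have := ht.mul_const (c t)⁻¹
    refine this.congr (ae_of_all _ fun x => ?_)
    simp only
    rw [mul_assoc, mul_inv_cancel₀ hct, mul_one]
  have e1 : ∫ x, w x t * c t * F x t ∂P = c t * ∫ x, F x t * w x t ∂P := by
    rw [← integral_const_mul]; congr 1; ext x; ring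
  rw [e1, integral_mul_const, integral_mul_const]
  by_cases hz : ∫ x, w x t ∂P = 0
  · have h0 := (integral_eq_zero_iff_of_nonneg (fun x => hw0 x t) hwi).mp hz
    have : ∫ x, F x t * w x t ∂P = 0 := by
      rw [← integral_zero (α := S) (G := ℝ) (μ := P)]
      refine integral_congr_ae ?_
      filter_upwards [h0] with x hx
      rw [hx]; simp
    rw [this]; simp
  · field_simp

/-- The observation map. -/
def obs {𝒴 : Type*} (n : ℕ) (sn a : ℝ) (ω : ((Fin n → ℝ) × 𝒴) × (Fin n → ℝ)) :
    ((Fin n → ℝ) × 𝒴) × (Fin n → ℝ) :=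
  ((0, ω.1.2), ω.2 + (a * Real.sqrt sn) • ω.1.1)

section
variable {𝒴 : Type*} [MeasurableSpace 𝒴] {n : ℕ} {K : ℝ} {P : Measure (Fin n → ℝ)}
  [IsProbabilityMeasure P] {ν : Measure ((Fin n → ℝ) × 𝒴)} [IsProbabilityMeasure ν]
  {W : (Fin n → ℝ) → 𝒴 → ℝ} {sn : ℝ}

@[fun_prop]
lemma obs_meas (n : ℕ) (sn a : ℝ) : Measurable (obs (𝒴 := 𝒴) n sn a) := by
  unfold obs; fun_prop

lemma hPert_obs (hs : sn ∈ Set.Ioc (0:ℝ) 1) (a : ℝ) (X z x : Fin n → ℝ) :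
    hPert n sn a 0 (z + (a * Real.sqrt sn) • X) x = hPert n sn a X z x := by
  unfold hPert
  refine Finset.sum_congr rfl fun i _ => ?_
  have := Real.mul_self_sqrt hs.1.le
  simp only [Pi.zero_apply, Pi.add_apply, Pi.smul_apply, smul_eq_mul]
  have e : a * Real.sqrt sn * (z i + a * Real.sqrt sn * X i) * x i
    = a * Real.sqrt sn * z i * x i + a ^ 2 * (Real.sqrt sn * Real.sqrt sn) * x i * X i := by ring
  rw [e, this]; ring

lemma hPert_zero (hs : sn ∈ Set.Ioc (0:ℝ) 1) (a : ℝ) (z x : Fin n → ℝ) :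
    hPert n sn a 0 z x = ∑ i, ((a * Real.sqrt sn) • x) i * z i
      - ∑ i, ((a * Real.sqrt sn) • x) i ^ 2 / 2 := by
  unfold hPert
  rw [← Finset.sum_sub_distrib]
  refine Finset.sum_congr rfl fun i _ => ?_
  have := Real.sq_sqrt hs.1.le
  simp only [Pi.zero_apply, Pi.smul_apply, smul_eq_mul]
  rw [mul_pow, mul_pow, this]; ring

lemma gibbs_obs (hs : sn ∈ Set.Ioc (0:ℝ) 1) (a : ℝ) (ω : ((Fin n → ℝ) × 𝒴) × (Fin n → ℝ))
    (f : (Fin n → ℝ) → ℝ) :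
    gibbsPert n P W sn a (obs n sn a ω) f = gibbsPert n P W sn a ω f := by
  unfold gibbsPert Zpert obs
  simp only [hPert_obs hs]

lemma Mdl.nu_eq (M : Mdl n K P ν W) :
    ν = (P.prod (ν.map Prod.snd)).withDensity
      (fun p => ENNReal.ofReal (W p.1 p.2 / ∫ x, W x p.2 ∂P)) := by
  have : IsProbabilityMeasure (ν.map Prod.snd) :=
    Measure.isProbabilityMeasure_map measurable_snd.aemeasurable
  have hD : Measurable fun p : (Fin n → ℝ) × 𝒴 => ENNReal.ofReal (W p.1 p.2 / ∫ x, W x p.2 ∂P) :=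
    (M.Wmeas.div (M.Z0_meas.comp measurable_snd)).ennreal_ofReal
  ext S hS
  have h := M.cond (S.indicator fun _ => 1) (measurable_const.indicator hS)
    ⟨1, fun p => by by_cases hp : p ∈ S <;> simp [hp]⟩
  rw [integral_indicator_const _ hS, smul_eq_mul, mul_one] at h
  have h1 : ν S = ENNReal.ofReal (ν.real S) := by simp [measureReal_def]
  rw [h1, h, withDensity_apply _ hS, ← lintegral_indicator hS,
    lintegral_prod_symm _ (hD.indicator hS).aemeasurable]
  have hgood : ∀ᵐ y ∂(ν.map Prod.snd), Integrable (fun x => W x y) P ∧ 0 < ∫ x, W x y ∂P := by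
    have hms : MeasurableSet {y : 𝒴 | 0 < (∫ x, W x y ∂P)} :=
      M.Z0_meas measurableSet_Ioi
    have : ∀ᵐ y ∂(ν.map Prod.snd), 0 < ∫ x, W x y ∂P := by
      rw [ae_map_iff measurable_snd.aemeasurable hms]
      exact M.good_ae.mono fun p G => G.pos
    filter_upwards [this] with y hy
    refine ⟨?_, hy⟩
    by_contra h
    exact hy.ne' (integral_undef h)
  have hind : ∀ x y, 0 ≤ S.indicator (fun _ => (1:ℝ)) (x, y) ∧
      S.indicator (fun _ => (1:ℝ)) (x, y) ≤ 1 := by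
    intro x y
    by_cases hp : (x, y) ∈ S <;> simp [hp]
  have hmi : Measurable fun p : (Fin n → ℝ) × 𝒴 => S.indicator (fun _ => (1:ℝ)) p :=
    measurable_const.indicator hS
  have hWint : ∀ y, Integrable (fun x => W x y) P →
      Integrable (fun x => S.indicator (fun _ => (1:ℝ)) (x, y) * W x y) P := by
    intro y hy
    refine hy.bdd_mul (c := 1) (hmi.comp (f := fun x => (x, y)) (by fun_prop)).aestronglyMeasurable
      (ae_of_all _ fun x => ?_)
    rw [norm_eq_abs, abs_of_nonneg (hind x y).1]; exact (hind x y).2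
  rw [ofReal_integral_eq_lintegral_ofReal]
  · refine lintegral_congr_ae ?_
    filter_upwards [hgood] with y ⟨hi, hp⟩
    rw [← integral_div, ofReal_integral_eq_lintegral_ofReal ((hWint y hi).div_const _)
      (ae_of_all _ fun x => div_nonneg (mul_nonneg (hind x y).1 (M.Wpos _ _)) hp.le)]
    refine lintegral_congr fun x => ?_
    by_cases hxy : (x, y) ∈ S <;> simp [hxy]
  · refine Integrable.of_bound (C := 1) ?_ ?_
    · have e := ((hmi.mul M.Wmeas).stronglyMeasurable.integral_prod_left' (μ := P)).measurable
      exact (e.div M.Z0_meas).aestronglyMeasurable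
    · filter_upwards [hgood] with y ⟨hi, hp⟩
      rw [norm_eq_abs, abs_of_nonneg (div_nonneg (integral_nonneg fun x =>
        mul_nonneg (hind x y).1 (M.Wpos _ _)) hp.le), div_le_one hp]
      refine integral_mono (hWint y hi) hi fun x => ?_
      exact mul_le_of_le_one_left (M.Wpos _ _) (hind x y).2
  · filter_upwards [hgood] with y ⟨hi, hp⟩
    exact div_nonneg (integral_nonneg fun x =>
        mul_nonneg (hind x y).1 (M.Wpos _ _)) hp.le

lemma Mdl.law_eq (M : Mdl n K P ν W) (hs : sn ∈ Set.Ioc (0:ℝ) 1) (a : ℝ) :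
    (pertSpace n ν).map (fun ω => (ω.1.1, (ω.1.2, ω.2 + (a * Real.sqrt sn) • ω.1.1)))
      = (P.prod ((ν.map Prod.snd).prod (gvec n))).withDensity
        (fun p => ENNReal.ofReal (W p.1 p.2.1 * Real.exp (hPert n sn a 0 p.2.2 p.1)
          * (∫ x, W x p.2.1 ∂P)⁻¹)) := by
  have : IsProbabilityMeasure (ν.map Prod.snd) :=
    Measure.isProbabilityMeasure_map measurable_snd.aemeasurable
  have hmE : Measurable fun p : (Fin n → ℝ) × 𝒴 × (Fin n → ℝ) =>
      ENNReal.ofReal (Real.exp (hPert n sn a 0 p.2.2 p.1)) := by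
    unfold hPert; fun_prop
  have hmD : Measurable fun p : (Fin n → ℝ) × 𝒴 =>
      ENNReal.ofReal (W p.1 p.2 / ∫ x, W x p.2 ∂P) :=
    (M.Wmeas.div (M.Z0_meas.comp measurable_snd)).ennreal_ofReal
  have hmD' : Measurable fun p : (Fin n → ℝ) × 𝒴 × (Fin n → ℝ) =>
      ENNReal.ofReal (W p.1 p.2.1 / ∫ x, W x p.2.1 ∂P) :=
    hmD.comp (f := fun p : (Fin n → ℝ) × 𝒴 × (Fin n → ℝ) => (p.1, p.2.1)) (by fun_prop)
  have e : (fun p : (Fin n → ℝ) × 𝒴 × (Fin n → ℝ) =>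
      ENNReal.ofReal (W p.1 p.2.1 * Real.exp (hPert n sn a 0 p.2.2 p.1)
          * (∫ x, W x p.2.1 ∂P)⁻¹))
      = fun p => ENNReal.ofReal (W p.1 p.2.1 / ∫ x, W x p.2.1 ∂P)
        * ENNReal.ofReal (Real.exp (hPert n sn a 0 p.2.2 p.1)) := by
    funext p
    rw [← ENNReal.ofReal_mul (div_nonneg (M.Wpos _ _) (integral_nonneg fun x => M.Wpos _ _))]
    congr 1; ring
  rw [e]
  have hmDE : Measurable fun p : (Fin n → ℝ) × 𝒴 × (Fin n → ℝ) =>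
      ENNReal.ofReal (W p.1 p.2.1 / ∫ x, W x p.2.1 ∂P)
        * ENNReal.ofReal (Real.exp (hPert n sn a 0 p.2.2 p.1)) := hmD'.mul hmE
  refine Measure.ext_of_lintegral _ fun f hf => ?_
  rw [lintegral_map hf (by fun_prop),
    lintegral_withDensity_eq_lintegral_mul _ hmDE hf,
    lintegral_prod _ (hmDE.mul hf).aemeasurable]
  unfold pertSpace
  have hfc : Measurable fun ω : ((Fin n → ℝ) × 𝒴) × (Fin n → ℝ) =>
      f (ω.1.1, ω.1.2, ω.2 + (a * Real.sqrt sn) • ω.1.1) :=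
    hf.comp (f := fun ω : ((Fin n → ℝ) × 𝒴) × (Fin n → ℝ) =>
      (ω.1.1, ω.1.2, ω.2 + (a * Real.sqrt sn) • ω.1.1)) (by fun_prop)
  rw [lintegral_prod _ hfc.aemeasurable]
  have h1 : ∀ p : (Fin n → ℝ) × 𝒴,
      ∫⁻ z, f (p.1, p.2, z + (a * Real.sqrt sn) • p.1) ∂(gvec n)
      = ∫⁻ z, ENNReal.ofReal (Real.exp (hPert n sn a 0 z p.1)) * f (p.1, p.2, z) ∂(gvec n) := by
    intro p
    rw [gvec_shift_lintegral ((a * Real.sqrt sn) • p.1) (fun z => f (p.1, p.2, z))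
      (hf.comp (by fun_prop))]
    simp_rw [hPert_zero hs]
  simp_rw [h1]
  have hmg : Measurable fun p : (Fin n → ℝ) × 𝒴 =>
      ∫⁻ z, ENNReal.ofReal (Real.exp (hPert n sn a 0 z p.1)) * f (p.1, p.2, z) ∂(gvec n) := by
    apply Measurable.lintegral_prod_right' (f := fun q : ((Fin n → ℝ) × 𝒴) × (Fin n → ℝ) =>
      ENNReal.ofReal (Real.exp (hPert n sn a 0 q.2 q.1.1)) * f (q.1.1, q.1.2, q.2))
    refine Measurable.mul ?_ (hf.comp (by fun_prop))
    exact hmE.comp (f := fun q : ((Fin n → ℝ) × 𝒴) × (Fin n → ℝ) => (q.1.1, q.1.2, q.2))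
      (by fun_prop)
  conv_lhs => rw [M.nu_eq]
  rw [lintegral_withDensity_eq_lintegral_mul _ hmD hmg, lintegral_prod _ (hmD.mul hmg).aemeasurable]
  refine lintegral_congr fun x => ?_
  have hmx : Measurable fun q : 𝒴 × (Fin n → ℝ) => (x, q) := by fun_prop
  refine Eq.trans ?_ (lintegral_prod _ ((hmDE.mul hf).comp hmx).aemeasurable).symm
  refine lintegral_congr fun y => ?_
  simp only [Pi.mul_apply, Function.comp_apply]
  rw [← lintegral_const_mul]
  · simp_rw [mul_assoc]
  · exact (hmE.mul hf).comp (f := fun z => (x, y, z)) (by fun_prop)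

lemma Mdl.nishimori (M : Mdl n K P ν W) (hs : sn ∈ Set.Ioc (0:ℝ) 1) (a : ℝ)
    (F : (Fin n → ℝ) → (((Fin n → ℝ) × 𝒴) × (Fin n → ℝ)) → ℝ)
    (hFm : Measurable fun p : (Fin n → ℝ) × (((Fin n → ℝ) × 𝒴) × (Fin n → ℝ)) => F p.1 p.2)
    (hF : Integrable (fun ω => F ω.1.1 (obs n sn a ω)) (pertSpace n ν))
    (hG : Integrable (fun ω => gibbsPert n P W sn a ω (fun x => F x (obs n sn a ω)))
      (pertSpace n ν)) :
    ∫ ω, F ω.1.1 (obs n sn a ω) ∂(pertSpace n ν)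
      = ∫ ω, gibbsPert n P W sn a ω (fun x => F x (obs n sn a ω)) ∂(pertSpace n ν) := by
  have : IsProbabilityMeasure (ν.map Prod.snd) :=
    Measure.isProbabilityMeasure_map measurable_snd.aemeasurable
  have hφ : Measurable fun ω : ((Fin n → ℝ) × 𝒴) × (Fin n → ℝ) =>
    (ω.1.1, (ω.1.2, ω.2 + (a * Real.sqrt sn) • ω.1.1)) := by fun_prop
  have hprob := Measure.isProbabilityMeasure_map (μ := pertSpace n ν) hφ.aemeasurable
  have law := M.law_eq hs a
  rw [law] at hprob
  set w : (Fin n → ℝ) → 𝒴 × (Fin n → ℝ) → ℝ :=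
    fun x t => W x t.1 * Real.exp (hPert n sn a 0 t.2 x) with hw
  have hwm : Measurable fun p : (Fin n → ℝ) × (𝒴 × (Fin n → ℝ)) => w p.1 p.2 :=
    (M.wt_meas sn a).comp
      (f := fun p : (Fin n → ℝ) × (𝒴 × (Fin n → ℝ)) => (((0, p.2.1), p.2.2), p.1)) (by fun_prop)
  have hc : Measurable fun t : 𝒴 × (Fin n → ℝ) => (∫ x, W x t.1 ∂P)⁻¹ :=
    (M.Z0_meas.comp measurable_fst).inv
  have e1 : ∀ ω, gibbsPert n P W sn a ω (fun x => F x (obs n sn a ω))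
      = (fun p : (Fin n → ℝ) × (𝒴 × (Fin n → ℝ)) =>
        (∫ x, F x ((0, p.2.1), p.2.2) * w x p.2 ∂P) / ∫ x, w x p.2 ∂P)
        (ω.1.1, (ω.1.2, ω.2 + (a * Real.sqrt sn) • ω.1.1)) := by
    intro ω
    rw [← gibbs_obs hs]
    rfl
  have e2 : ∀ ω : ((Fin n → ℝ) × 𝒴) × (Fin n → ℝ), F ω.1.1 (obs n sn a ω)
      = (fun p : (Fin n → ℝ) × (𝒴 × (Fin n → ℝ)) => F p.1 ((0, p.2.1), p.2.2))
        (ω.1.1, (ω.1.2, ω.2 + (a * Real.sqrt sn) • ω.1.1)) := fun ω => rfl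
  have hm2 : Measurable fun p : (Fin n → ℝ) × (𝒴 × (Fin n → ℝ)) => F p.1 ((0, p.2.1), p.2.2) :=
    hFm.comp (f := fun p : (Fin n → ℝ) × (𝒴 × (Fin n → ℝ)) => (p.1, ((0, p.2.1), p.2.2)))
      (by fun_prop)
  have hm1 : Measurable fun p : (Fin n → ℝ) × (𝒴 × (Fin n → ℝ)) =>
        (∫ x, F x ((0, p.2.1), p.2.2) * w x p.2 ∂P) / ∫ x, w x p.2 ∂P := by
    have q1 := ((hm2.mul hwm).stronglyMeasurable.integral_prod_left' (μ := P)).measurable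
    have q2 := (hwm.stronglyMeasurable.integral_prod_left' (μ := P)).measurable
    exact (q1.div q2).comp measurable_snd
  have hF' := (integrable_map_measure hm2.aestronglyMeasurable hφ.aemeasurable).mpr hF
  have hG' := (integrable_map_measure (μ := pertSpace n ν) hm1.aestronglyMeasurable
    hφ.aemeasurable).mpr (hG.congr (ae_of_all _ e1))
  rw [law] at hF' hG'
  have i1 := integral_map (μ := pertSpace n ν) hφ.aemeasurable hm2.aestronglyMeasurable
  have i2 := integral_map (μ := pertSpace n ν) hφ.aemeasurable hm1.aestronglyMeasurable
  rw [law] at i1 i2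
  rw [integral_congr_ae (ae_of_all _ e1)]
  refine i1.symm.trans (Eq.trans ?_ i2)
  exact nishi_abs P ((ν.map Prod.snd).prod (gvec n)) w (fun t => (∫ x, W x t.1 ∂P)⁻¹)
    hwm hc (fun x t => mul_nonneg (M.Wpos _ _) (Real.exp_pos _).le)
    (fun t => inv_nonneg.mpr (integral_nonneg fun x => M.Wpos _ _)) hprob
    (fun x t => F x ((0, t.1), t.2)) hF' hG'

end

/-- Functions of `(ω,x)` with linear growth in the noise. -/
def Nice {𝒴 : Type*} [MeasurableSpace 𝒴] {n : ℕ} (K : ℝ) (P : Measure (Fin n → ℝ))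
    (W : (Fin n → ℝ) → 𝒴 → ℝ)
    (f : (((Fin n → ℝ) × 𝒴) × (Fin n → ℝ)) → (Fin n → ℝ) → ℝ) : Prop :=
  (Measurable fun p : (((Fin n → ℝ) × 𝒴) × (Fin n → ℝ)) × (Fin n → ℝ) => f p.1 p.2) ∧
  ∃ C, 0 ≤ C ∧ ∀ ω, Good K P W ω.1.1 ω.1.2 → ∀ x, (∀ i, |x i| ≤ K) →
    |f ω x| ≤ C * (1 + ∑ i, |ω.2 i|)

/-- Bounded functions of `(ω,x)`. -/
def Bdd {𝒴 : Type*} [MeasurableSpace 𝒴] {n : ℕ} (K : ℝ) (P : Measure (Fin n → ℝ))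
    (W : (Fin n → ℝ) → 𝒴 → ℝ)
    (f : (((Fin n → ℝ) × 𝒴) × (Fin n → ℝ)) → (Fin n → ℝ) → ℝ) : Prop :=
  (Measurable fun p : (((Fin n → ℝ) × 𝒴) × (Fin n → ℝ)) × (Fin n → ℝ) => f p.1 p.2) ∧
  ∃ C, 0 ≤ C ∧ ∀ ω, Good K P W ω.1.1 ω.1.2 → ∀ x, (∀ i, |x i| ≤ K) → |f ω x| ≤ C

/-- Quenched Gibbs average. -/
def EG {𝒴 : Type*} [MeasurableSpace 𝒴] (n : ℕ) (P : Measure (Fin n → ℝ))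
    (W : (Fin n → ℝ) → 𝒴 → ℝ) (ν : Measure ((Fin n → ℝ) × 𝒴)) [IsProbabilityMeasure ν]
    (sn a : ℝ) (f : (((Fin n → ℝ) × 𝒴) × (Fin n → ℝ)) → (Fin n → ℝ) → ℝ) : ℝ :=
  ∫ ω, gibbsPert n P W sn a ω (f ω) ∂(pertSpace n ν)

/-- Posterior mean. -/
def mm {𝒴 : Type*} [MeasurableSpace 𝒴] (n : ℕ) (P : Measure (Fin n → ℝ))
    (W : (Fin n → ℝ) → 𝒴 → ℝ) (sn a : ℝ)
    (ω : ((Fin n → ℝ) × 𝒴) × (Fin n → ℝ)) : Fin n → ℝ :=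
  fun i => gibbsPert n P W sn a ω (fun x => x i)

lemma ovl_meas {α : Type*} [MeasurableSpace α] {n : ℕ} {f g : α → Fin n → ℝ}
    (hf : Measurable f) (hg : Measurable g) : Measurable fun p => ovl n (f p) (g p) := by
  unfold ovl; fun_prop

lemma ovl_comm (n : ℕ) (x y : Fin n → ℝ) : ovl n x y = ovl n y x := by
  unfold ovl; simp_rw [mul_comm]

lemma ovl_bd {n : ℕ} {K : ℝ} (hK : 0 < K) {x y : Fin n → ℝ} (hx : ∀ i, |x i| ≤ K)
    (hy : ∀ i, |y i| ≤ K) : |ovl n x y| ≤ K ^ 2 := by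
  unfold ovl
  have h : |∑ i, x i * y i| ≤ ∑ i : Fin n, K ^ 2 := by
    refine (Finset.abs_sum_le_sum_abs _ _).trans (Finset.sum_le_sum fun i _ => ?_)
    rw [abs_mul, sq]
    exact mul_le_mul (hx i) (hy i) (abs_nonneg _) hK.le
  simp only [Finset.sum_const, Finset.card_univ, Fintype.card_fin, nsmul_eq_mul] at h
  rw [abs_mul, abs_of_nonneg (by positivity)]
  rcases Nat.eq_zero_or_pos n with rfl | hn
  · simp; positivity
  have hn' : (0:ℝ) < n := by exact_mod_cast hn
  calc _ ≤ 1 / (n:ℝ) * (n * K ^ 2) := by gcongr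
    _ = K ^ 2 := by field_simp

section
variable {𝒴 : Type*} [MeasurableSpace 𝒴] {n : ℕ} {K : ℝ} {P : Measure (Fin n → ℝ)}
  [IsProbabilityMeasure P] {ν : Measure ((Fin n → ℝ) × 𝒴)} [IsProbabilityMeasure ν]
  {W : (Fin n → ℝ) → 𝒴 → ℝ} {sn : ℝ}

lemma Bdd.nice {f : (((Fin n → ℝ) × 𝒴) × (Fin n → ℝ)) → (Fin n → ℝ) → ℝ}
    (hf : Bdd K P W f) : Nice K P W f := by
  obtain ⟨m, C, hC, h⟩ := hf
  refine ⟨m, C, hC, fun ω G x hx => (h ω G x hx).trans ?_⟩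
  have : 0 ≤ ∑ i, |ω.2 i| := Finset.sum_nonneg fun i _ => abs_nonneg _
  nlinarith

lemma Nice.add {f g : (((Fin n → ℝ) × 𝒴) × (Fin n → ℝ)) → (Fin n → ℝ) → ℝ}
    (hf : Nice K P W f) (hg : Nice K P W g) : Nice K P W fun ω x => f ω x + g ω x := by
  obtain ⟨m, C, hC, h⟩ := hf
  obtain ⟨m', C', hC', h'⟩ := hg
  refine ⟨m.add m', C + C', by positivity, fun ω G x hx => (abs_add_le _ _).trans ?_⟩
  have h1 := h ω G x hx
  have h2 := h' ω G x hx
  linarith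

lemma Nice.mul {f g : (((Fin n → ℝ) × 𝒴) × (Fin n → ℝ)) → (Fin n → ℝ) → ℝ}
    (hf : Nice K P W f) (hg : Bdd K P W g) : Nice K P W fun ω x => f ω x * g ω x := by
  obtain ⟨m, C, hC, h⟩ := hf
  obtain ⟨m', C', hC', h'⟩ := hg
  refine ⟨m.mul m', C * C', by positivity, fun ω G x hx => ?_⟩
  rw [abs_mul]
  have h1 := h ω G x hx
  have h2 := h' ω G x hx
  calc _ ≤ (C * (1 + ∑ i, |ω.2 i|)) * C' :=
        mul_le_mul h1 h2 (abs_nonneg _) ((abs_nonneg _).trans h1)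
    _ = _ := by ring

lemma Bdd.mul {f g : (((Fin n → ℝ) × 𝒴) × (Fin n → ℝ)) → (Fin n → ℝ) → ℝ}
    (hf : Bdd K P W f) (hg : Bdd K P W g) : Bdd K P W fun ω x => f ω x * g ω x := by
  obtain ⟨m, C, hC, h⟩ := hf
  obtain ⟨m', C', hC', h'⟩ := hg
  refine ⟨m.mul m', C * C', by positivity, fun ω G x hx => ?_⟩
  rw [abs_mul]
  exact mul_le_mul (h ω G x hx) (h' ω G x hx) (abs_nonneg _) hC

lemma Bdd.const (c : ℝ) : Bdd (𝒴 := 𝒴) K P W fun ω x => c :=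
  ⟨measurable_const, |c|, abs_nonneg _, fun _ _ _ _ => le_rfl⟩

lemma Nice.const_mul {f : (((Fin n → ℝ) × 𝒴) × (Fin n → ℝ)) → (Fin n → ℝ) → ℝ}
    (hf : Nice K P W f) (c : ℝ) : Nice K P W fun ω x => c * f ω x := by
  have := hf.mul (Bdd.const (𝒴 := 𝒴) (K := K) (P := P) (W := W) c)
  simpa [mul_comm] using this

lemma Nice.abs {f : (((Fin n → ℝ) × 𝒴) × (Fin n → ℝ)) → (Fin n → ℝ) → ℝ}
    (hf : Nice K P W f) : Nice K P W fun ω x => |f ω x| := by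
  obtain ⟨m, C, hC, h⟩ := hf
  exact ⟨continuous_abs.measurable.comp m, C, hC, fun ω G x hx => by rw [abs_abs]; exact h ω G x hx⟩

lemma Mdl.int_dom (M : Mdl n K P ν W) {f : (((Fin n → ℝ) × 𝒴) × (Fin n → ℝ)) → ℝ}
    (hf : Measurable f) (C : ℝ)
    (h : ∀ ω, Good K P W ω.1.1 ω.1.2 → |f ω| ≤ C * (1 + ∑ i, |ω.2 i|)) :
    Integrable f (pertSpace n ν) := by
  have hg : Integrable (fun z : Fin n → ℝ => C * (1 + ∑ i, |z i|)) (gvec n) :=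
    ((integrable_const _).add (integrable_finsetSum _ fun i _ => gvec_abs_integrable i)).const_mul C
  have hg' : Integrable (fun ω : ((Fin n → ℝ) × 𝒴) × (Fin n → ℝ) => C * (1 + ∑ i, |ω.2 i|))
      (pertSpace n ν) := hg.comp_snd ν
  refine hg'.mono' hf.aestronglyMeasurable ?_
  filter_upwards [M.good_ae'] with ω G
  exact h ω G

lemma Mdl.gibbs_bd (M : Mdl n K P ν W) (hs : sn ∈ Set.Ioc (0:ℝ) 1) (a : ℝ)
    {ω : ((Fin n → ℝ) × 𝒴) × (Fin n → ℝ)} (G : Good K P W ω.1.1 ω.1.2) {f : (Fin n → ℝ) → ℝ}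
    {c : ℝ} (h : ∀ x, (∀ i, |x i| ≤ K) → |f x| ≤ c) : |gibbsPert n P W sn a ω f| ≤ c := by
  have := M.gm_prob hs a G ω.2
  rw [M.gibbs_eq]
  have := norm_integral_le_of_norm_le_const (μ := gm n P W sn a ω) (f := f) (C := c)
    ((M.gm_supp sn a ω).mono fun x hx => h x hx)
  rw [measureReal_def] at this
  have e : gm n P W sn a ω Set.univ = 1 := (M.gm_prob hs a G ω.2).measure_univ
  rw [e] at this
  simpa using this

lemma Mdl.gibbs_int (M : Mdl n K P ν W) (hs : sn ∈ Set.Ioc (0:ℝ) 1) (a : ℝ)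
    {ω : ((Fin n → ℝ) × 𝒴) × (Fin n → ℝ)} (G : Good K P W ω.1.1 ω.1.2) {f : (Fin n → ℝ) → ℝ}
    (hf : Measurable f)
    {c : ℝ} (h : ∀ x, (∀ i, |x i| ≤ K) → |f x| ≤ c) : Integrable f (gm n P W sn a ω) := by
  have : IsProbabilityMeasure (gm n P W sn a ω) := M.gm_prob hs a G ω.2
  exact Integrable.of_bound hf.aestronglyMeasurable c
    ((M.gm_supp sn a ω).mono fun x hx => h x hx)

lemma Mdl.gibbs_congr (M : Mdl n K P ν W) (a : ℝ)
    (ω : ((Fin n → ℝ) × 𝒴) × (Fin n → ℝ)) {f g : (Fin n → ℝ) → ℝ}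
    (h : ∀ x, (∀ i, |x i| ≤ K) → f x = g x) :
    gibbsPert n P W sn a ω f = gibbsPert n P W sn a ω g := by
  rw [M.gibbs_eq, M.gibbs_eq]
  exact integral_congr_ae ((M.gm_supp sn a ω).mono fun x hx => h x hx)

lemma Mdl.gibbs_const (M : Mdl n K P ν W) (hs : sn ∈ Set.Ioc (0:ℝ) 1) (a : ℝ)
    {ω : ((Fin n → ℝ) × 𝒴) × (Fin n → ℝ)} (G : Good K P W ω.1.1 ω.1.2) (c : ℝ) :
    gibbsPert n P W sn a ω (fun _ => c) = c := by
  have : IsProbabilityMeasure (gm n P W sn a ω) := M.gm_prob hs a G ω.2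
  rw [M.gibbs_eq]; simp

lemma Mdl.gibbs_const_mul (M : Mdl n K P ν W) (sn a : ℝ)
    (ω : ((Fin n → ℝ) × 𝒴) × (Fin n → ℝ)) (c : ℝ) (f : (Fin n → ℝ) → ℝ) :
    gibbsPert n P W sn a ω (fun x => c * f x) = c * gibbsPert n P W sn a ω f := by
  rw [M.gibbs_eq, M.gibbs_eq, integral_const_mul]

lemma Nice.slice {f : (((Fin n → ℝ) × 𝒴) × (Fin n → ℝ)) → (Fin n → ℝ) → ℝ}
    (hf : Nice K P W f) (ω) : Measurable (f ω) :=
  hf.1.comp (f := fun x => (ω, x)) (by fun_prop)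

lemma Mdl.nice_gint (M : Mdl n K P ν W) (hs : sn ∈ Set.Ioc (0:ℝ) 1) (a : ℝ)
    {f : (((Fin n → ℝ) × 𝒴) × (Fin n → ℝ)) → (Fin n → ℝ) → ℝ} (hf : Nice K P W f)
    {ω} (G : Good K P W ω.1.1 ω.1.2) : Integrable (f ω) (gm n P W sn a ω) := by
  obtain ⟨C, hC, h⟩ := hf.2
  exact M.gibbs_int hs a G (hf.slice ω) (h ω G)

lemma Mdl.nice_int (M : Mdl n K P ν W) (hs : sn ∈ Set.Ioc (0:ℝ) 1) (a : ℝ)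
    {f : (((Fin n → ℝ) × 𝒴) × (Fin n → ℝ)) → (Fin n → ℝ) → ℝ} (hf : Nice K P W f) :
    Integrable (fun ω => gibbsPert n P W sn a ω (f ω)) (pertSpace n ν) := by
  obtain ⟨m, C, hC, h⟩ := hf
  exact M.int_dom (M.gibbs_meas sn a m) C fun ω G => M.gibbs_bd hs a G (h ω G)

lemma Mdl.nice_int_X (M : Mdl n K P ν W)
    {f : (((Fin n → ℝ) × 𝒴) × (Fin n → ℝ)) → (Fin n → ℝ) → ℝ} (hf : Nice K P W f) :
    Integrable (fun ω => f ω ω.1.1) (pertSpace n ν) := by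
  obtain ⟨m, C, hC, h⟩ := hf
  exact M.int_dom (m.comp (f := fun ω : ((Fin n → ℝ) × 𝒴) × (Fin n → ℝ) => (ω, ω.1.1))
    (by fun_prop)) C fun ω G => h ω G _ G.bd

lemma Mdl.EG_congr (M : Mdl n K P ν W) (a : ℝ)
    {f g : (((Fin n → ℝ) × 𝒴) × (Fin n → ℝ)) → (Fin n → ℝ) → ℝ}
    (h : ∀ ω, Good K P W ω.1.1 ω.1.2 → ∀ x, (∀ i, |x i| ≤ K) → f ω x = g ω x) :
    EG n P W ν sn a f = EG n P W ν sn a g := by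
  unfold EG
  refine integral_congr_ae ?_
  filter_upwards [M.good_ae'] with ω G
  exact M.gibbs_congr a ω (h ω G)

lemma Mdl.EG_add (M : Mdl n K P ν W) (hs : sn ∈ Set.Ioc (0:ℝ) 1) (a : ℝ)
    {f g : (((Fin n → ℝ) × 𝒴) × (Fin n → ℝ)) → (Fin n → ℝ) → ℝ}
    (hf : Nice K P W f) (hg : Nice K P W g) :
    EG n P W ν sn a (fun ω x => f ω x + g ω x) = EG n P W ν sn a f + EG n P W ν sn a g := by
  unfold EG
  rw [← integral_add (M.nice_int hs a hf) (M.nice_int hs a hg)]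
  refine integral_congr_ae ?_
  filter_upwards [M.good_ae'] with ω G
  simp only [M.gibbs_eq]
  rw [integral_add (M.nice_gint hs a hf G) (M.nice_gint hs a hg G)]

lemma Mdl.EG_const_mul (M : Mdl n K P ν W) (sn a c : ℝ)
    (f : (((Fin n → ℝ) × 𝒴) × (Fin n → ℝ)) → (Fin n → ℝ) → ℝ) :
    EG n P W ν sn a (fun ω x => c * f ω x) = c * EG n P W ν sn a f := by
  unfold EG
  simp_rw [M.gibbs_const_mul, integral_const_mul]

lemma Mdl.EG_mono (M : Mdl n K P ν W) (hs : sn ∈ Set.Ioc (0:ℝ) 1) (a : ℝ)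
    {f g : (((Fin n → ℝ) × 𝒴) × (Fin n → ℝ)) → (Fin n → ℝ) → ℝ}
    (hf : Nice K P W f) (hg : Nice K P W g)
    (h : ∀ ω, Good K P W ω.1.1 ω.1.2 → ∀ x, (∀ i, |x i| ≤ K) → f ω x ≤ g ω x) :
    EG n P W ν sn a f ≤ EG n P W ν sn a g := by
  unfold EG
  refine integral_mono_ae (M.nice_int hs a hf) (M.nice_int hs a hg) ?_
  filter_upwards [M.good_ae'] with ω G
  simp only [M.gibbs_eq]
  exact integral_mono_ae (M.nice_gint hs a hf G) (M.nice_gint hs a hg G)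
    ((M.gm_supp sn a ω).mono fun x hx => h ω G x hx)

lemma Mdl.mm_meas (M : Mdl n K P ν W) (sn a : ℝ) : Measurable (mm n P W sn a) := by
  refine measurable_pi_lambda _ fun i => ?_
  exact M.gibbs_meas sn a (f := fun ω x => x i) (by fun_prop)

lemma Mdl.mm_bd (M : Mdl n K P ν W) (hs : sn ∈ Set.Ioc (0:ℝ) 1) (a : ℝ)
    {ω : ((Fin n → ℝ) × 𝒴) × (Fin n → ℝ)} (G : Good K P W ω.1.1 ω.1.2) (i) :
    |mm n P W sn a ω i| ≤ K := M.gibbs_bd hs a G fun x hx => hx i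

lemma mm_obs (hs : sn ∈ Set.Ioc (0:ℝ) 1) (a : ℝ) (ω : ((Fin n → ℝ) × 𝒴) × (Fin n → ℝ)) :
    mm n P W sn a (obs n sn a ω) = mm n P W sn a ω := by
  funext i; exact gibbs_obs hs a ω _

lemma Mdl.gibbs_ovl (M : Mdl n K P ν W) (hs : sn ∈ Set.Ioc (0:ℝ) 1) (a : ℝ)
    {ω : ((Fin n → ℝ) × 𝒴) × (Fin n → ℝ)} (G : Good K P W ω.1.1 ω.1.2) (v : Fin n → ℝ) :
    gibbsPert n P W sn a ω (fun x => ovl n v x) = ovl n v (mm n P W sn a ω) := by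
  unfold ovl mm
  rw [M.gibbs_const_mul, M.gibbs_eq, integral_finsetSum]
  · simp_rw [integral_const_mul, M.gibbs_eq]
  · intro i _
    exact (M.gibbs_int hs a G (measurable_pi_apply i) fun x hx => hx i).const_mul _

lemma Mdl.nishi (M : Mdl n K P ν W) (hs : sn ∈ Set.Ioc (0:ℝ) 1) (a : ℝ)
    (F : (Fin n → ℝ) → (((Fin n → ℝ) × 𝒴) × (Fin n → ℝ)) → ℝ)
    (hFm : Measurable fun p : (Fin n → ℝ) × (((Fin n → ℝ) × 𝒴) × (Fin n → ℝ)) => F p.1 p.2)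
    (hF : Nice K P W (fun ω x => F x (obs n sn a ω))) :
    ∫ ω, F ω.1.1 (obs n sn a ω) ∂(pertSpace n ν)
      = EG n P W ν sn a (fun ω x => F x (obs n sn a ω)) :=
  M.nishimori hs a F hFm (M.nice_int_X hF) (M.nice_int hs a hF)

end

lemma tilt_deriv {S : Type*} [MeasurableSpace S] (κ : Measure S) [IsProbabilityMeasure κ]
    (O : S → ℝ) (hO : Measurable O) (C : ℝ) (hOC : ∀ᵐ x ∂κ, |O x| ≤ C) :
    HasDerivAt (fun u : ℝ => (∫ x, O x * Real.exp (u * O x) ∂κ) / ∫ x, Real.exp (u * O x) ∂κ)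
      ((∫ x, O x ^ 2 ∂κ) - (∫ x, O x ∂κ) ^ 2) 0 := by
  have hset : integrableExpSet O κ = Set.univ := by
    ext t
    simp only [integrableExpSet, Set.mem_ofPred_eq, Set.mem_univ, iff_true]
    refine Integrable.of_bound (Measurable.aestronglyMeasurable (by fun_prop))
      (Real.exp (|t| * C)) ?_
    filter_upwards [hOC] with x hx
    rw [norm_eq_abs, Real.abs_exp]
    refine Real.exp_le_exp.mpr ((le_abs_self _).trans ?_)
    rw [abs_mul]; gcongr
  have h0 : (0:ℝ) ∈ interior (integrableExpSet O κ) := by simp [hset]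
  have d0 := hasDerivAt_integral_pow_mul_exp_real h0 0
  have d1 := hasDerivAt_integral_pow_mul_exp_real h0 1
  simp only [pow_zero, one_mul, zero_add, pow_one, zero_mul, Real.exp_zero, mul_one] at d0 d1
  have := d1.div d0 (by simp)
  refine this.congr_deriv ?_
  simp
  ring

section
variable {𝒴 : Type*} [MeasurableSpace 𝒴] {n : ℕ} {K : ℝ} {P : Measure (Fin n → ℝ)}
  [IsProbabilityMeasure P] {ν : Measure ((Fin n → ℝ) × 𝒴)} [IsProbabilityMeasure ν]
  {W : (Fin n → ℝ) → 𝒴 → ℝ} {sn : ℝ}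

lemma hPert_shift (hn : 0 < n) (sn a t : ℝ) (X z x : Fin n → ℝ) :
    hPert n sn a X (z + t • X) x
      = hPert n sn a X z x + (t * (a * Real.sqrt sn * n)) * ovl n X x := by
  have hn' : (n:ℝ) ≠ 0 := by exact_mod_cast hn.ne'
  unfold hPert ovl
  have e : t * (a * Real.sqrt sn * n) * (1 / (n:ℝ) * ∑ i, X i * x i)
    = ∑ i, t * (a * Real.sqrt sn) * (X i * x i) := by
    rw [← Finset.mul_sum]; field_simp
  rw [e, ← Finset.sum_add_distrib]
  refine Finset.sum_congr rfl fun i _ => ?_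
  simp only [Pi.add_apply, Pi.smul_apply, smul_eq_mul]
  ring

lemma Mdl.gibbs_shift (M : Mdl n K P ν W) (hs : sn ∈ Set.Ioc (0:ℝ) 1) (hn : 0 < n) (a t : ℝ)
    {X : Fin n → ℝ} {y : 𝒴} (G : Good K P W X y) (z : Fin n → ℝ) (f : (Fin n → ℝ) → ℝ) :
    gibbsPert n P W sn a ((X, y), z + t • X) f
      = gibbsPert n P W sn a ((X, y), z)
          (fun x => f x * Real.exp ((t * (a * Real.sqrt sn * n)) * ovl n X x))
        / gibbsPert n P W sn a ((X, y), z)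
          (fun x => Real.exp ((t * (a * Real.sqrt sn * n)) * ovl n X x)) := by
  have hZ := (M.Z_pos hs a G z).ne'
  unfold gibbsPert
  rw [div_div_div_cancel_right₀ hZ]
  unfold Zpert
  simp only [hPert_shift hn, Real.exp_add]
  congr 1
  · congr 1; ext x; ring
  · congr 1; ext x; ring

lemma Mdl.ibp_z (M : Mdl n K P ν W) (hs : sn ∈ Set.Ioc (0:ℝ) 1) (hn : 0 < n) (a : ℝ)
    {X : Fin n → ℝ} {y : 𝒴} (G : Good K P W X y) :
    ∫ z, (∑ i, X i * z i) * gibbsPert n P W sn a ((X, y), z) (fun x => ovl n X x) ∂(gvec n)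
      = ∫ z, (a * Real.sqrt sn * n) *
        (gibbsPert n P W sn a ((X, y), z) (fun x => ovl n X x ^ 2)
          - gibbsPert n P W sn a ((X, y), z) (fun x => ovl n X x) ^ 2) ∂(gvec n) := by
  have mO : Measurable fun x => ovl n X x := ovl_meas measurable_const measurable_id
  have mg : Measurable fun z => gibbsPert n P W sn a ((X, y), z) (fun x => ovl n X x) :=
    (M.gibbs_meas sn a (f := fun ω x => ovl n X x) (mO.comp measurable_snd)).comp
      (f := fun z => ((X, y), z)) (by fun_prop)
  have mg2 : Measurable fun z => gibbsPert n P W sn a ((X, y), z) (fun x => ovl n X x ^ 2) :=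
    (M.gibbs_meas sn a (f := fun ω x => ovl n X x ^ 2) ((mO.pow_const 2).comp measurable_snd)).comp
      (f := fun z => ((X, y), z)) (by fun_prop)
  have b1 : ∀ z, |gibbsPert n P W sn a ((X, y), z) (fun x => ovl n X x)| ≤ K ^ 2 := fun z =>
    M.gibbs_bd hs a G fun x hx => ovl_bd M.Kpos G.bd hx
  have b2 : ∀ z, |gibbsPert n P W sn a ((X, y), z) (fun x => ovl n X x ^ 2)| ≤ K ^ 4 := fun z =>
    M.gibbs_bd hs a G fun x hx => by
      rw [abs_pow]
      calc _ ≤ (K ^ 2) ^ 2 := by gcongr; exact ovl_bd M.Kpos G.bd hx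
        _ = K ^ 4 := by ring
  refine gvec_ibp X _ _ (K ^ 2 + |a * Real.sqrt sn * n| * (K ^ 4 + K ^ 4)) mg
    ((mg2.sub (mg.pow_const 2)).const_mul _) (fun z => (b1 z).trans ?_) (fun z => ?_) (fun z => ?_)
  · have : 0 ≤ |a * Real.sqrt sn * n| * (K ^ 4 + K ^ 4) := by positivity
    linarith
  · rw [abs_mul]
    have h1 : |gibbsPert n P W sn a ((X, y), z) (fun x => ovl n X x ^ 2)
          - gibbsPert n P W sn a ((X, y), z) (fun x => ovl n X x) ^ 2| ≤ K ^ 4 + K ^ 4 := by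
      refine (abs_sub _ _).trans (add_le_add (b2 z) ?_)
      rw [abs_pow]
      calc _ ≤ (K ^ 2) ^ 2 := by gcongr; exact b1 z
        _ = K ^ 4 := by ring
    have : |a * Real.sqrt sn * n| * |gibbsPert n P W sn a ((X, y), z) (fun x => ovl n X x ^ 2)
          - gibbsPert n P W sn a ((X, y), z) (fun x => ovl n X x) ^ 2|
        ≤ |a * Real.sqrt sn * n| * (K ^ 4 + K ^ 4) := by gcongr
    have : 0 ≤ K ^ 2 := by positivity
    linarith
  · have := M.gm_prob hs a G z
    simp_rw [M.gibbs_shift hs hn a _ G z, M.gibbs_eq]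
    have d := tilt_deriv (gm n P W sn a ((X, y), z)) (fun x => ovl n X x) mO (K ^ 2)
      ((M.gm_supp sn a _).mono fun x hx => ovl_bd M.Kpos G.bd hx)
    have l : HasDerivAt (fun t : ℝ => t * (a * Real.sqrt sn * n)) (a * Real.sqrt sn * n) 0 := by
      simpa using (hasDerivAt_id (0:ℝ)).mul_const (a * Real.sqrt sn * n)
    have d' : HasDerivAt (fun u : ℝ => (∫ x, ovl n X x * Real.exp (u * ovl n X x)
        ∂(gm n P W sn a ((X, y), z)))
        / ∫ x, Real.exp (u * ovl n X x) ∂(gm n P W sn a ((X, y), z)))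
        ((∫ x, ovl n X x ^ 2 ∂(gm n P W sn a ((X, y), z)))
          - (∫ x, ovl n X x ∂(gm n P W sn a ((X, y), z))) ^ 2)
        ((fun t : ℝ => t * (a * Real.sqrt sn * n)) 0) := by simpa using d
    have := d'.comp (0:ℝ) l
    exact this.congr_deriv (mul_comm _ _)

lemma Bdd.X_mm (M : Mdl n K P ν W) (hs : sn ∈ Set.Ioc (0:ℝ) 1) (a : ℝ) :
    Bdd K P W (fun ω x => ovl n x (mm n P W sn a ω)) :=
  ⟨ovl_meas measurable_snd ((M.mm_meas sn a).comp measurable_fst), K ^ 2, by positivity,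
    fun ω G x hx => ovl_bd M.Kpos hx (M.mm_bd hs a G)⟩

lemma Bdd.X_x (M : Mdl n K P ν W) :
    Bdd K P W (fun ω x => ovl n ω.1.1 x) :=
  ⟨ovl_meas (by fun_prop) measurable_snd, K ^ 2, by positivity,
    fun ω G x hx => ovl_bd M.Kpos G.bd hx⟩

lemma Nice.zx (M : Mdl n K P ν W) :
    Nice (𝒴 := 𝒴) K P W (fun ω x => ∑ i, x i * ω.2 i) := by
  refine ⟨by fun_prop, K, M.Kpos.le, fun ω G x hx => ?_⟩
  have : |∑ i, x i * ω.2 i| ≤ ∑ i, K * |ω.2 i| :=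
    (Finset.abs_sum_le_sum_abs _ _).trans (Finset.sum_le_sum fun i _ => by
      rw [abs_mul]; gcongr; exact hx i)
  rw [← Finset.mul_sum] at this
  have := M.Kpos
  linarith

lemma Mdl.ibp_E (M : Mdl n K P ν W) (hs : sn ∈ Set.Ioc (0:ℝ) 1) (hn : 0 < n) (a : ℝ) :
    ∫ ω, (∑ i, ω.1.1 i * ω.2 i) * ovl n ω.1.1 (mm n P W sn a ω) ∂(pertSpace n ν)
      = (a * Real.sqrt sn * n) * (EG n P W ν sn a (fun ω x => ovl n ω.1.1 x * ovl n ω.1.1 x)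
        - ∫ ω, ovl n ω.1.1 (mm n P W sn a ω) * ovl n ω.1.1 (mm n P W sn a ω)
          ∂(pertSpace n ν)) := by
  have i1 := M.nice_int_X ((Nice.zx M).mul (Bdd.X_mm M hs a))
  have i2 := M.nice_int hs a ((Bdd.X_x M).mul (Bdd.X_x M)).nice
  have i3 := M.nice_int_X ((Bdd.X_mm M hs a).mul (Bdd.X_mm M hs a)).nice
  unfold EG
  rw [← integral_sub i2 i3, ← integral_const_mul]
  have i4 := (i2.sub i3).const_mul (a * Real.sqrt sn * n)
  unfold pertSpace at i1 i4 ⊢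
  rw [integral_prod _ i1]
  refine Eq.trans ?_ (integral_prod _ i4).symm
  refine integral_congr_ae ?_
  filter_upwards [M.good_ae] with p G
  have h := M.ibp_z (a := a) hs hn G
  have e : ∀ z, gibbsPert n P W sn a ((p.1, p.2), z) (fun x => ovl n p.1 x)
      = ovl n p.1 (mm n P W sn a (p, z)) := fun z => M.gibbs_ovl hs a (ω := (p, z)) G p.1
  simp_rw [e] at h
  refine h.trans ?_
  congr 1; ext z
  simp only [Pi.sub_apply, sq]

lemma Mdl.zX_zero (M : Mdl n K P ν W) :
    ∫ ω, (∑ i, ω.1.1 i * ω.2 i) ∂(pertSpace n ν) = 0 := by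
  have i1 := M.nice_int_X (Nice.zx (P := P) (W := W) M)
  unfold pertSpace at i1 ⊢
  rw [integral_prod _ i1]
  rw [← integral_zero (α := (Fin n → ℝ) × 𝒴) (G := ℝ) (μ := ν)]
  congr 1; ext p
  have := gvec_ibp p.1 (fun _ => 1) (fun _ => 0) 1 measurable_const measurable_const
    (fun z => by simp) (fun z => by simp) (fun z => hasDerivAt_const _ _)
  simpa using this

lemma hU_eq (hs : sn ∈ Set.Ioc (0:ℝ) 1) (hn : 0 < n) (a : ℝ)
    (ω : ((Fin n → ℝ) × 𝒴) × (Fin n → ℝ)) (x : Fin n → ℝ) :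
    hU n sn a ω.1.1 ω.2 x
      = (Real.sqrt sn * ∑ i, x i * (obs n sn a ω).2 i - a * sn * ∑ i, x i * x i) / (n * sn)
        + a * ovl n ω.1.1 x := by
  have hn' : (0:ℝ) < n := by exact_mod_cast hn
  have h0 := hs.1
  have e : (Real.sqrt sn * ∑ i, x i * (obs n sn a ω).2 i)
      = Real.sqrt sn * (∑ i, ω.2 i * x i) + a * sn * ∑ i, ω.1.1 i * x i := by
    unfold obs
    simp only [Pi.add_apply, Pi.smul_apply, smul_eq_mul, Finset.mul_sum]
    rw [← Finset.sum_add_distrib]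
    refine Finset.sum_congr rfl fun i _ => ?_
    have := Real.mul_self_sqrt hs.1.le
    calc _ = Real.sqrt sn * (ω.2 i * x i)
        + a * (Real.sqrt sn * Real.sqrt sn) * (ω.1.1 i * x i) := by ring
      _ = _ := by rw [this]
  rw [e]
  unfold hU hA hB ovl
  have e2 : ∑ i, (x i * ω.1.1 i - x i ^ 2 / 2) = (∑ i, ω.1.1 i * x i) - (∑ i, x i * x i) / 2 := by
    rw [Finset.sum_div, ← Finset.sum_sub_distrib]
    refine Finset.sum_congr rfl fun i _ => by ring
  rw [e2]
  field_simp
  ring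

lemma Nice.T (M : Mdl n K P ν W) (hs : sn ∈ Set.Ioc (0:ℝ) 1) (hn : 0 < n) (a : ℝ) :
    Nice (𝒴 := 𝒴) K P W (fun ω x =>
      (Real.sqrt sn * ∑ i, x i * (obs n sn a ω).2 i - a * sn * ∑ i, x i * x i) / (n * sn)) := by
  have hn' : (0:ℝ) < n := by exact_mod_cast hn
  have h0 := hs.1
  have h1 : Nice (𝒴 := 𝒴) K P W (fun ω x => hU n sn a ω.1.1 ω.2 x) := by
    refine ⟨(hU_meas n sn a).comp (f := fun p : (((Fin n → ℝ) × 𝒴) × (Fin n → ℝ)) × (Fin n → ℝ)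
      => (p.1.1.1, p.1.2, p.2)) (by fun_prop), K / (n * sn) + 3 * |a| * K ^ 2,
      by have := M.Kpos; positivity, fun ω G x hx => (M.U_bd hs hn a _ _ _ G.bd hx).trans ?_⟩
    have h2 : 0 ≤ ∑ i, |ω.2 i| := Finset.sum_nonneg fun i _ => abs_nonneg _
    have h3 : 0 ≤ K / (n * sn) := by have := M.Kpos; positivity
    have h4 : 0 ≤ 3 * |a| * K ^ 2 := by positivity
    have h5 : K * (∑ i, |ω.2 i|) / (n * sn) = K / (n * sn) * ∑ i, |ω.2 i| := by ring
    rw [h5]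
    nlinarith
  have := h1.add ((Bdd.X_x M).nice.const_mul (-a))
  refine (congrArg (Nice K P W) ?_).mp this
  funext ω x
  rw [hU_eq hs hn]; ring

lemma Nice.U (M : Mdl n K P ν W) (hs : sn ∈ Set.Ioc (0:ℝ) 1) (hn : 0 < n) (a : ℝ) :
    Nice (𝒴 := 𝒴) K P W (fun ω x => hU n sn a ω.1.1 ω.2 x) := by
  have := (Nice.T M hs hn a).add ((Bdd.X_x M).nice.const_mul a)
  refine (congrArg (Nice K P W) ?_).mp this
  funext ω x
  rw [hU_eq hs hn]

lemma T_X (hs : sn ∈ Set.Ioc (0:ℝ) 1) (a : ℝ)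
    (ω : ((Fin n → ℝ) × 𝒴) × (Fin n → ℝ)) :
    (Real.sqrt sn * ∑ i, ω.1.1 i * (obs n sn a ω).2 i
      - a * sn * ∑ i, ω.1.1 i * ω.1.1 i) / (n * sn)
    = (Real.sqrt sn / (n * sn)) * ∑ i, ω.1.1 i * ω.2 i := by
  have e : Real.sqrt sn * ∑ i, ω.1.1 i * (obs n sn a ω).2 i
      = Real.sqrt sn * (∑ i, ω.1.1 i * ω.2 i) + a * sn * ∑ i, ω.1.1 i * ω.1.1 i := by
    unfold obs
    simp only [Pi.add_apply, Pi.smul_apply, smul_eq_mul, Finset.mul_sum]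
    rw [← Finset.sum_add_distrib]
    refine Finset.sum_congr rfl fun i _ => ?_
    have := Real.mul_self_sqrt hs.1.le
    calc _ = Real.sqrt sn * (ω.1.1 i * ω.2 i)
        + a * (Real.sqrt sn * Real.sqrt sn) * (ω.1.1 i * ω.1.1 i) := by ring
      _ = _ := by rw [this]
  rw [e]; ring

lemma Mdl.meanOv_eq (M : Mdl n K P ν W) (hs : sn ∈ Set.Ioc (0:ℝ) 1) (a : ℝ) :
    meanOv n P W ν sn a = EG n P W ν sn a (fun ω x => ovl n x (mm n P W sn a ω)) := by
  unfold meanOv EG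
  refine integral_congr_ae ?_
  filter_upwards [M.good_ae'] with ω G
  refine M.gibbs_congr a ω fun x hx => M.gibbs_ovl hs a G x

/-- `E[X·m] = Q`. -/
lemma Mdl.EXm (M : Mdl n K P ν W) (hs : sn ∈ Set.Ioc (0:ℝ) 1) (a : ℝ) :
    ∫ ω, ovl n ω.1.1 (mm n P W sn a ω) ∂(pertSpace n ν) = meanOv n P W ν sn a := by
  rw [M.meanOv_eq hs]
  have := M.nishi hs a (fun x t => ovl n x (mm n P W sn a t))
    (ovl_meas measurable_fst ((M.mm_meas sn a).comp measurable_snd))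
    (by simpa only [mm_obs hs] using (Bdd.X_mm M hs a).nice)
  simpa only [mm_obs hs] using this

lemma Mdl.EXm2 (M : Mdl n K P ν W) (hs : sn ∈ Set.Ioc (0:ℝ) 1) (a : ℝ) :
    ∫ ω, ovl n ω.1.1 (mm n P W sn a ω) * ovl n ω.1.1 (mm n P W sn a ω) ∂(pertSpace n ν)
      = EG n P W ν sn a
        (fun ω x => ovl n x (mm n P W sn a ω) * ovl n x (mm n P W sn a ω)) := by
  have m1 : Measurable fun p : (Fin n → ℝ) × (((Fin n → ℝ) × 𝒴) × (Fin n → ℝ)) =>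
      ovl n p.1 (mm n P W sn a p.2) :=
    ovl_meas measurable_fst ((M.mm_meas sn a).comp measurable_snd)
  have := M.nishi hs a (fun x t => ovl n x (mm n P W sn a t) * ovl n x (mm n P W sn a t))
    (m1.mul m1)
    (by simpa only [mm_obs hs] using ((Bdd.X_mm M hs a).mul (Bdd.X_mm M hs a)).nice)
  simpa only [mm_obs hs] using this

/-- `E⟨U⟩ = a Q`. -/
lemma Mdl.EU (M : Mdl n K P ν W) (hs : sn ∈ Set.Ioc (0:ℝ) 1) (hn : 0 < n) (a : ℝ) :
    EG n P W ν sn a (fun ω x => hU n sn a ω.1.1 ω.2 x) = a * meanOv n P W ν sn a := by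
  simp_rw [hU_eq hs hn]
  rw [M.EG_add hs a (Nice.T M hs hn a) ((Bdd.X_x M).nice.const_mul a), M.EG_const_mul]
  have h1 := M.nishi hs a (fun x t =>
    (Real.sqrt sn * ∑ i, x i * t.2 i - a * sn * ∑ i, x i * x i) / (n * sn))
    (by fun_prop) (Nice.T M hs hn a)
  rw [← h1]
  simp_rw [T_X hs, integral_const_mul]
  rw [M.zX_zero]
  have h2 : EG n P W ν sn a (fun ω x => ovl n ω.1.1 x) = meanOv n P W ν sn a := by
    rw [← M.EXm hs]
    unfold EG
    refine integral_congr_ae ?_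
    filter_upwards [M.good_ae'] with ω G
    exact M.gibbs_ovl hs a G _
  rw [h2]; ring

/-- Mixed term. -/
lemma Mdl.EXxm (M : Mdl n K P ν W) (hs : sn ∈ Set.Ioc (0:ℝ) 1) (a : ℝ) :
    EG n P W ν sn a (fun ω x => ovl n ω.1.1 x * ovl n x (mm n P W sn a ω))
      = EG n P W ν sn a
        (fun ω x => ovl n x (mm n P W sn a ω) * ovl n x (mm n P W sn a ω)) := by
  set g : (((Fin n → ℝ) × 𝒴) × (Fin n → ℝ)) → Fin n → ℝ := fun ω i =>
    gibbsPert n P W sn a ω (fun x => x i * ovl n x (mm n P W sn a ω)) with hg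
  have mov : Measurable fun p : (((Fin n → ℝ) × 𝒴) × (Fin n → ℝ)) × (Fin n → ℝ) =>
      ovl n p.2 (mm n P W sn a p.1) :=
    ovl_meas measurable_snd ((M.mm_meas sn a).comp measurable_fst)
  have gm : Measurable g := by
    refine measurable_pi_lambda _ fun i => ?_
    exact M.gibbs_meas sn a (f := fun ω x => x i * ovl n x (mm n P W sn a ω))
      (Measurable.mul (by fun_prop) mov)
  have gobs : ∀ ω, g (obs n sn a ω) = g ω := by
    intro ω; funext i
    simp only [hg, mm_obs hs, gibbs_obs hs]
  have bxi : ∀ ω : ((Fin n → ℝ) × 𝒴) × (Fin n → ℝ), Good K P W ω.1.1 ω.1.2 →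
      ∀ i, ∀ x, (∀ i, |x i| ≤ K) → |x i * ovl n x (mm n P W sn a ω)| ≤ K * K ^ 2 := by
    intro ω G i x hx
    rw [abs_mul]
    exact mul_le_mul (hx i) (ovl_bd M.Kpos hx (M.mm_bd hs a G)) (abs_nonneg _) M.Kpos.le
  have gb : ∀ ω : ((Fin n → ℝ) × 𝒴) × (Fin n → ℝ), Good K P W ω.1.1 ω.1.2 →
      ∀ i, |g ω i| ≤ K + K * K ^ 2 := by
    intro ω G i
    have := M.gibbs_bd hs a G (bxi ω G i)
    have := M.Kpos
    simp only [hg]; linarith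
  have lin : ∀ ω : ((Fin n → ℝ) × 𝒴) × (Fin n → ℝ), Good K P W ω.1.1 ω.1.2 → ∀ v : Fin n → ℝ,
      gibbsPert n P W sn a ω (fun x => ovl n v x * ovl n x (mm n P W sn a ω)) = ovl n v (g ω) := by
    intro ω G v
    have e : ∀ x, ovl n v x * ovl n x (mm n P W sn a ω)
        = (1 / (n:ℝ)) * ∑ i, v i * (x i * ovl n x (mm n P W sn a ω)) := by
      intro x
      conv_lhs => rw [show ovl n v x = (1 / (n:ℝ)) * ∑ i, v i * x i from rfl]
      rw [mul_assoc, Finset.sum_mul]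
      congr 1
      exact Finset.sum_congr rfl fun i _ => by ring
    simp_rw [e]
    rw [M.gibbs_const_mul, M.gibbs_eq, integral_finsetSum]
    · simp_rw [integral_const_mul]
      unfold ovl
      simp only [hg, M.gibbs_eq]
      rfl
    · intro i _
      refine (M.gibbs_int hs a G ?_ (bxi ω G i)).const_mul _
      exact (measurable_pi_apply i).mul (ovl_meas measurable_id measurable_const)
  have hK' : 0 < K + K * K ^ 2 := by have := M.Kpos; positivity
  have s1 : EG n P W ν sn a (fun ω x => ovl n ω.1.1 x * ovl n x (mm n P W sn a ω))
      = ∫ ω, ovl n ω.1.1 (g ω) ∂(pertSpace n ν) := by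
    unfold EG
    refine integral_congr_ae ?_
    filter_upwards [M.good_ae'] with ω G
    exact lin ω G _
  have s2 : EG n P W ν sn a
        (fun ω x => ovl n x (mm n P W sn a ω) * ovl n x (mm n P W sn a ω))
      = ∫ ω, ovl n (mm n P W sn a ω) (g ω) ∂(pertSpace n ν) := by
    unfold EG
    refine integral_congr_ae ?_
    filter_upwards [M.good_ae'] with ω G
    rw [← lin ω G]
    simp_rw [ovl_comm n (mm n P W sn a ω)]
  have s3 : EG n P W ν sn a (fun ω x => ovl n x (g ω))
      = ∫ ω, ovl n (mm n P W sn a ω) (g ω) ∂(pertSpace n ν) := by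
    unfold EG
    refine integral_congr_ae ?_
    filter_upwards [M.good_ae'] with ω G
    simp_rw [ovl_comm n _ (g ω)]
    exact M.gibbs_ovl hs a G _
  have nice : Nice K P W (fun ω x => ovl n x (g ω)) := by
    refine Bdd.nice ⟨ovl_meas measurable_snd (gm.comp measurable_fst), (K + K * K ^ 2) ^ 2,
      by positivity, fun ω G x hx => ovl_bd hK' (fun i => (hx i).trans ?_) (gb ω G)⟩
    have := M.Kpos
    have : 0 ≤ K * K ^ 2 := by positivity
    linarith
  have := M.nishi hs a (fun x t => ovl n x (g t)) (ovl_meas measurable_fst (gm.comp measurable_snd))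
    (by simpa only [gobs] using nice)
  simp only [gobs] at this
  rw [s1, s2, ← s3, this]

/-- `E⟨U (x·m)⟩ = a E⟨(x·X)²⟩`. -/
lemma Mdl.EUxm (M : Mdl n K P ν W) (hs : sn ∈ Set.Ioc (0:ℝ) 1) (hn : 0 < n) (a : ℝ) :
    EG n P W ν sn a (fun ω x => hU n sn a ω.1.1 ω.2 x * ovl n x (mm n P W sn a ω))
      = a * EG n P W ν sn a (fun ω x => ovl n ω.1.1 x * ovl n ω.1.1 x) := by
  have hn' : (0:ℝ) < n := by exact_mod_cast hn
  have h0 := hs.1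
  simp_rw [hU_eq hs hn, add_mul, mul_assoc a (ovl n _ _)]
  rw [M.EG_add hs a ((Nice.T M hs hn a).mul (Bdd.X_mm M hs a))
    (((Bdd.X_x M).mul (Bdd.X_mm M hs a)).nice.const_mul a), M.EG_const_mul]
  have m1 : Measurable fun p : (Fin n → ℝ) × (((Fin n → ℝ) × 𝒴) × (Fin n → ℝ)) =>
      ovl n p.1 (mm n P W sn a p.2) :=
    ovl_meas measurable_fst ((M.mm_meas sn a).comp measurable_snd)
  have h1 := M.nishi hs a (fun x t =>
    (Real.sqrt sn * ∑ i, x i * t.2 i - a * sn * ∑ i, x i * x i) / (n * sn)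
      * ovl n x (mm n P W sn a t))
    (Measurable.mul (by fun_prop) m1)
    (by simpa only [mm_obs hs] using (Nice.T M hs hn a).mul (Bdd.X_mm M hs a))
  simp only [mm_obs hs] at h1
  rw [← h1]
  simp_rw [T_X hs, mul_assoc (Real.sqrt sn / _), integral_const_mul]
  rw [M.ibp_E hs hn, M.EXxm hs, ← M.EXm2 hs]
  have := Real.mul_self_sqrt hs.1.le
  have e : Real.sqrt sn / (n * sn) * (a * Real.sqrt sn * n) = a := by
    rw [div_mul_eq_mul_div, div_eq_iff (by positivity)]
    linear_combination (a * n) * this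
  rw [← mul_assoc, e]; ring

/-- `E⟨(x·X)²⟩ = E⟨⟨(x1·x2)²⟩⟩`. -/
lemma Mdl.EXx2 (M : Mdl n K P ν W) (hs : sn ∈ Set.Ioc (0:ℝ) 1) (a : ℝ) :
    EG n P W ν sn a (fun ω x => ovl n ω.1.1 x * ovl n ω.1.1 x)
      = EG n P W ν sn a (fun ω x1 => gibbsPert n P W sn a ω (fun x => ovl n x1 x * ovl n x1 x)) := by
  have m0 : Measurable fun p : ((Fin n → ℝ) × (((Fin n → ℝ) × 𝒴) × (Fin n → ℝ))) × (Fin n → ℝ) =>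
      ovl n p.1.1 p.2 := ovl_meas (by fun_prop) measurable_snd
  have m1 : Measurable fun p : (Fin n → ℝ) × (((Fin n → ℝ) × 𝒴) × (Fin n → ℝ)) =>
      gibbsPert n P W sn a p.2 (fun x => ovl n p.1 x * ovl n p.1 x) := by
    unfold gibbsPert
    have w : Measurable fun p : ((Fin n → ℝ) × (((Fin n → ℝ) × 𝒴) × (Fin n → ℝ)))
        × (Fin n → ℝ) => W p.2 p.1.2.1.2 * Real.exp (hPert n sn a p.1.2.1.1 p.1.2.2 p.2) :=
      (M.wt_meas sn a).comp (f := fun p : ((Fin n → ℝ) × (((Fin n → ℝ) × 𝒴) × (Fin n → ℝ)))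
        × (Fin n → ℝ) => (p.1.2, p.2)) (by fun_prop)
    have q := (((m0.mul m0).mul w).stronglyMeasurable.integral_prod_right' (ν := P)).measurable
    exact q.div ((M.Zpert_meas sn a).comp measurable_snd)
  have nice : Nice K P W fun ω x1 =>
      gibbsPert n P W sn a ω (fun x => ovl n x1 x * ovl n x1 x) := by
    refine Bdd.nice ⟨m1.comp (f := fun p : (((Fin n → ℝ) × 𝒴) × (Fin n → ℝ)) × (Fin n → ℝ) =>
      (p.2, p.1)) (by fun_prop), K ^ 2 * K ^ 2, by positivity, fun ω G x1 hx1 => ?_⟩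
    refine M.gibbs_bd hs a G fun x hx => ?_
    rw [abs_mul]
    have := ovl_bd M.Kpos hx1 hx
    gcongr
  have := M.nishi hs a (fun x1 t => gibbsPert n P W sn a t (fun x => ovl n x1 x * ovl n x1 x)) m1
    (by simpa only [gibbs_obs hs] using nice)
  simp only [gibbs_obs hs] at this
  rw [← this]
  rfl

lemma Mdl.meanOv_bd (M : Mdl n K P ν W) (hs : sn ∈ Set.Ioc (0:ℝ) 1) (a : ℝ) :
    |meanOv n P W ν sn a| ≤ K ^ 2 := by
  rw [← M.EXm hs]
  have := norm_integral_le_of_norm_le_const (μ := pertSpace n ν)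
    (f := fun ω => ovl n ω.1.1 (mm n P W sn a ω)) (C := K ^ 2)
    (M.good_ae'.mono fun ω G => ovl_bd M.Kpos G.bd (M.mm_bd hs a G))
  simpa using this

end

/-- The overlap variance. -/
def VarOv {𝒴 : Type*} [MeasurableSpace 𝒴] (n : ℕ) (P : Measure (Fin n → ℝ))
    (W : (Fin n → ℝ) → 𝒴 → ℝ) (ν : Measure ((Fin n → ℝ) × 𝒴)) [IsProbabilityMeasure ν]
    (sn a : ℝ) : ℝ :=
  ∫ ω, gibbsPert n P W sn a ω (fun x1 => gibbsPert n P W sn a ω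
    (fun x2 => (ovl n x1 x2 - meanOv n P W ν sn a) ^ 2)) ∂(pertSpace n ν)

section
variable {𝒴 : Type*} [MeasurableSpace 𝒴] {n : ℕ} {K : ℝ} {P : Measure (Fin n → ℝ)}
  [IsProbabilityMeasure P] {ν : Measure ((Fin n → ℝ) × 𝒴)} [IsProbabilityMeasure ν]
  {W : (Fin n → ℝ) → 𝒴 → ℝ} {sn : ℝ}

lemma Mdl.EG_const (M : Mdl n K P ν W) (hs : sn ∈ Set.Ioc (0:ℝ) 1) (a c : ℝ) :
    EG n P W ν sn a (fun _ _ => c) = c := by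
  unfold EG
  have : ∀ᵐ ω ∂(pertSpace n ν), gibbsPert n P W sn a ω (fun _ => c) = c :=
    M.good_ae'.mono fun ω G => M.gibbs_const hs a G c
  rw [integral_congr_ae this]; simp

lemma Mdl.Var_nonneg (M : Mdl n K P ν W) (a : ℝ) : 0 ≤ VarOv n P W ν sn a := by
  unfold VarOv
  simp only [M.gibbs_eq]
  exact integral_nonneg fun ω => integral_nonneg fun x1 => integral_nonneg fun x2 => sq_nonneg _

lemma Mdl.Var_eq (M : Mdl n K P ν W) (hs : sn ∈ Set.Ioc (0:ℝ) 1) (a : ℝ) :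
    VarOv n P W ν sn a
      = EG n P W ν sn a (fun ω x1 => gibbsPert n P W sn a ω (fun x => ovl n x1 x * ovl n x1 x))
        - meanOv n P W ν sn a ^ 2 := by
  set Q := meanOv n P W ν sn a with hQ
  have m1 : Measurable fun p : (((Fin n → ℝ) × 𝒴) × (Fin n → ℝ)) × (Fin n → ℝ) =>
      gibbsPert n P W sn a p.1 (fun x => ovl n p.2 x * ovl n p.2 x) := by
    have m0 : Measurable fun p : ((((Fin n → ℝ) × 𝒴) × (Fin n → ℝ)) × (Fin n → ℝ)) × (Fin n → ℝ) =>
      ovl n p.1.2 p.2 := ovl_meas (by fun_prop) measurable_snd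
    unfold gibbsPert
    have w : Measurable fun p : ((((Fin n → ℝ) × 𝒴) × (Fin n → ℝ)) × (Fin n → ℝ))
        × (Fin n → ℝ) => W p.2 p.1.1.1.2 * Real.exp (hPert n sn a p.1.1.1.1 p.1.1.2 p.2) :=
      (M.wt_meas sn a).comp (f := fun p : ((((Fin n → ℝ) × 𝒴) × (Fin n → ℝ)) × (Fin n → ℝ))
        × (Fin n → ℝ) => (p.1.1, p.2)) (by fun_prop)
    have q := (((m0.mul m0).mul w).stronglyMeasurable.integral_prod_right' (ν := P)).measurable
    exact q.div ((M.Zpert_meas sn a).comp measurable_fst)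
  have nice : Nice K P W fun ω x1 =>
      gibbsPert n P W sn a ω (fun x => ovl n x1 x * ovl n x1 x) := by
    refine Bdd.nice ⟨m1, K ^ 2 * K ^ 2, by positivity, fun ω G x1 hx1 => ?_⟩
    refine M.gibbs_bd hs a G fun x hx => ?_
    rw [abs_mul]
    have := ovl_bd M.Kpos hx1 hx
    gcongr
  have e : VarOv n P W ν sn a = EG n P W ν sn a (fun ω x1 =>
      (gibbsPert n P W sn a ω (fun x => ovl n x1 x * ovl n x1 x)
        + (-2 * Q) * ovl n x1 (mm n P W sn a ω)) + Q ^ 2) := by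
    refine M.EG_congr a fun ω G x1 hx1 => ?_
    have mo : Measurable fun x => ovl n x1 x := ovl_meas measurable_const measurable_id
    have : IsProbabilityMeasure (gm n P W sn a ω) := M.gm_prob hs a G ω.2
    have i1 : Integrable (fun x => ovl n x1 x) (gm n P W sn a ω) :=
      M.gibbs_int hs a G mo fun x hx => ovl_bd M.Kpos hx1 hx
    have i2 : Integrable (fun x => ovl n x1 x * ovl n x1 x) (gm n P W sn a ω) :=
      M.gibbs_int hs a G (mo.mul mo) (c := K ^ 2 * K ^ 2) fun x hx => by
        rw [abs_mul]
        have := ovl_bd M.Kpos hx1 hx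
        gcongr
    rw [← M.gibbs_ovl hs a G, M.gibbs_eq, M.gibbs_eq, M.gibbs_eq, ← integral_const_mul,
      ← integral_add i2 (i1.const_mul _)]
    have : ∫ x, (ovl n x1 x * ovl n x1 x + (-2 * Q) * ovl n x1 x) ∂(gm n P W sn a ω) + Q ^ 2
      = ∫ x, ((ovl n x1 x * ovl n x1 x + (-2 * Q) * ovl n x1 x) + Q ^ 2) ∂(gm n P W sn a ω) := by
      have i3 : Integrable (fun x => ovl n x1 x * ovl n x1 x + (-2 * Q) * ovl n x1 x)
          (gm n P W sn a ω) := i2.add (i1.const_mul _)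
      rw [integral_add i3 (integrable_const _)]; simp
    rw [this]
    congr 1; ext x; ring
  rw [e, M.EG_add hs a (nice.add ((Bdd.X_mm M hs a).nice.const_mul _)) (Bdd.const _).nice,
    M.EG_add hs a nice ((Bdd.X_mm M hs a).nice.const_mul _), M.EG_const_mul, M.EG_const hs,
    ← M.meanOv_eq hs, ← hQ]
  ring

lemma Mdl.Var_le (M : Mdl n K P ν W) (hs : sn ∈ Set.Ioc (0:ℝ) 1) (hn : 0 < n) {a : ℝ}
    (ha : 1 ≤ a) :
    VarOv n P W ν sn a ≤ K ^ 2 * EG n P W ν sn a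
      (fun ω x => |hU n sn a ω.1.1 ω.2 x - a * meanOv n P W ν sn a|) := by
  set Q := meanOv n P W ν sn a with hQ
  have nU := Nice.U M hs hn a
  have nUc : Nice K P W (fun ω x => hU n sn a ω.1.1 ω.2 x - a * Q) := by
    have := nU.add (Bdd.const (𝒴 := 𝒴) (K := K) (P := P) (W := W) (-(a * Q))).nice
    simpa only [← sub_eq_add_neg] using this
  have e : a * VarOv n P W ν sn a = EG n P W ν sn a (fun ω x =>
      (hU n sn a ω.1.1 ω.2 x - a * Q) * ovl n x (mm n P W sn a ω)) := by
    have e1 : EG n P W ν sn a (fun ω x =>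
      (hU n sn a ω.1.1 ω.2 x - a * Q) * ovl n x (mm n P W sn a ω))
      = EG n P W ν sn a (fun ω x => hU n sn a ω.1.1 ω.2 x * ovl n x (mm n P W sn a ω)
        + (-(a * Q)) * ovl n x (mm n P W sn a ω)) := by
      congr 1; ext ω x; ring
    rw [e1, M.EG_add hs a (nU.mul (Bdd.X_mm M hs a)) ((Bdd.X_mm M hs a).nice.const_mul _),
      M.EG_const_mul, ← M.meanOv_eq hs, M.EUxm hs hn, M.EXx2 hs, M.Var_eq hs, ← hQ]
    ring
  have h0 := M.Var_nonneg (sn := sn) a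
  calc VarOv n P W ν sn a ≤ a * VarOv n P W ν sn a := by nlinarith
    _ = _ := e
    _ ≤ EG n P W ν sn a (fun ω x => K ^ 2 * |hU n sn a ω.1.1 ω.2 x - a * Q|) := by
      refine M.EG_mono hs a (nUc.mul (Bdd.X_mm M hs a)) (nUc.abs.const_mul _) fun ω G x hx => ?_
      refine (le_abs_self _).trans ?_
      rw [abs_mul, mul_comm]
      have := ovl_bd M.Kpos hx (M.mm_bd hs a G)
      gcongr
    _ = _ := M.EG_const_mul _ _ _ _

lemma Mdl.phi_meas (M : Mdl n K P ν W) (sn a : ℝ) : Measurable (phiPert n P W sn a) := by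
  unfold phiPert
  exact (Real.measurable_log.comp (M.Zpert_meas sn a)).const_mul _

/-- Dominating function for the free energy. -/
def phiDom {𝒴 : Type*} [MeasurableSpace 𝒴] (n : ℕ) (K : ℝ) (P : Measure (Fin n → ℝ))
    (W : (Fin n → ℝ) → 𝒴 → ℝ) (sn A : ℝ) (ω : ((Fin n → ℝ) × 𝒴) × (Fin n → ℝ)) : ℝ :=
  (1 / ((n : ℝ) * sn)) * (|Real.log (∫ x, W x ω.1.2 ∂P)|
      + (A * (K * ∑ i, |ω.2 i|) + A ^ 2 * (n * sn * (3 / 2 * K ^ 2))))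

lemma Mdl.phiDom_int (M : Mdl n K P ν W) (sn A : ℝ) :
    Integrable (phiDom n K P W sn A) (pertSpace n ν) := by
  have h1 : Integrable (fun p : (Fin n → ℝ) × 𝒴 => |Real.log (∫ x, W x p.2 ∂P)|) ν :=
    (M.logZint.comp_measurable measurable_snd).abs
  have h1' : Integrable (fun ω : ((Fin n → ℝ) × 𝒴) × (Fin n → ℝ) =>
    |Real.log (∫ x, W x ω.1.2 ∂P)|) (pertSpace n ν) := h1.comp_fst (gvec n)
  have hg : Integrable (fun z : Fin n → ℝ => A * (K * ∑ i, |z i|)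
      + A ^ 2 * (n * sn * (3 / 2 * K ^ 2))) (gvec n) :=
    (((integrable_finsetSum _ fun i _ => gvec_abs_integrable i).const_mul K).const_mul A).add
      (integrable_const _)
  have hg' : Integrable (fun ω : ((Fin n → ℝ) × 𝒴) × (Fin n → ℝ) => A * (K * ∑ i, |ω.2 i|)
      + A ^ 2 * (n * sn * (3 / 2 * K ^ 2))) (pertSpace n ν) := hg.comp_snd ν
  exact (h1'.add hg').const_mul _

lemma Mdl.phi_dom (M : Mdl n K P ν W) (hs : sn ∈ Set.Ioc (0:ℝ) 1) {a A : ℝ}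
    (ha : |a| ≤ A) : ∀ᵐ ω ∂(pertSpace n ν), ‖phiPert n P W sn a ω‖ ≤ phiDom n K P W sn A ω := by
  filter_upwards [M.good_ae'] with ω G
  have h := M.logZ_bd hs a G ω.2
  have h0 := hs.1
  have hK := M.Kpos
  unfold phiPert phiDom
  rw [norm_eq_abs, abs_mul, abs_of_nonneg (by positivity : 0 ≤ 1 / ((n:ℝ) * sn))]
  have h2 : 0 ≤ ∑ i, |ω.2 i| := Finset.sum_nonneg fun i _ => abs_nonneg _
  have h3 : a ^ 2 ≤ A ^ 2 := by rw [← sq_abs]; gcongr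
  gcongr
  refine h.trans ?_
  gcongr

lemma Mdl.phi_int (M : Mdl n K P ν W) (hs : sn ∈ Set.Ioc (0:ℝ) 1) (a : ℝ) :
    Integrable (phiPert n P W sn a) (pertSpace n ν) :=
  (M.phiDom_int sn |a|).mono' (M.phi_meas sn a).aestronglyMeasurable (M.phi_dom hs le_rfl)

lemma Mdl.v_le (M : Mdl n K P ν W) (hs : sn ∈ Set.Ioc (0:ℝ) 1) {a : ℝ}
    (ha : a ∈ Set.Icc (1 / 2 : ℝ) 3) :
    ∫ ω, |phiPert n P W sn a ω - ∫ ω', phiPert n P W sn a ω' ∂(pertSpace n ν)|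
      ∂(pertSpace n ν) ≤ vnPert n P W ν sn := by
  unfold vnPert
  refine le_ciSup (f := fun a : Set.Icc (1 / 2 : ℝ) 3 =>
    ∫ ω, |phiPert n P W sn a ω - ∫ ω', phiPert n P W sn a ω' ∂(pertSpace n ν)|
      ∂(pertSpace n ν)) ?_ ⟨a, ha⟩
  refine ⟨2 * ∫ ω, phiDom n K P W sn 3 ω ∂(pertSpace n ν), ?_⟩
  rintro _ ⟨⟨b, hb⟩, rfl⟩
  have hb3 : |b| ≤ 3 := by
    rw [abs_le]; constructor <;> linarith [hb.1, hb.2]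
  have d := M.phi_dom hs hb3
  have i0 := M.phi_int hs b
  have iD := M.phiDom_int (P := P) (W := W) sn 3
  have h1 : |∫ ω', phiPert n P W sn b ω' ∂(pertSpace n ν)|
      ≤ ∫ ω, phiDom n K P W sn 3 ω ∂(pertSpace n ν) := norm_integral_le_of_norm_le iD d
  have h2 : ∫ ω, |phiPert n P W sn b ω - ∫ ω', phiPert n P W sn b ω' ∂(pertSpace n ν)|
      ∂(pertSpace n ν) ≤ ∫ ω, (phiDom n K P W sn 3 ω
        + ∫ ω, phiDom n K P W sn 3 ω ∂(pertSpace n ν)) ∂(pertSpace n ν) := by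
    refine integral_mono_ae (i0.sub (integrable_const _)).abs (iD.add (integrable_const _)) ?_
    filter_upwards [d] with ω hω
    exact (abs_sub _ _).trans (add_le_add hω h1)
  refine h2.trans (le_of_eq ?_)
  rw [integral_add iD (integrable_const _)]
  simp; ring

lemma Mdl.f_lower (M : Mdl n K P ν W) (hs : sn ∈ Set.Ioc (0:ℝ) 1) (hn : 0 < n) (a t : ℝ) :
    t * (a * meanOv n P W ν sn a) - 3 / 2 * K ^ 2 * t ^ 2
      ≤ (∫ ω, phiPert n P W sn (a + t) ω ∂(pertSpace n ν))
        - ∫ ω, phiPert n P W sn a ω ∂(pertSpace n ν) := by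
  have iU := M.nice_int hs a (Nice.U M hs hn a)
  rw [← M.EU hs hn, ← integral_sub (M.phi_int hs _) (M.phi_int hs _)]
  have e : t * EG n P W ν sn a (fun ω x => hU n sn a ω.1.1 ω.2 x) - 3 / 2 * K ^ 2 * t ^ 2
      = ∫ ω, (t * gibbsPert n P W sn a ω (fun x => hU n sn a ω.1.1 ω.2 x)
        - 3 / 2 * K ^ 2 * t ^ 2) ∂(pertSpace n ν) := by
    rw [integral_sub (iU.const_mul t) (integrable_const _), integral_const_mul]
    simp [EG]
  rw [e]
  refine integral_mono_ae ((iU.const_mul t).sub (integrable_const _))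
    ((M.phi_int hs _).sub (M.phi_int hs _)) ?_
  filter_upwards [M.good_ae'] with ω G
  exact M.phi_lower hs hn a t G ω.2

/-- The monotone function `p`. -/
def pfun {𝒴 : Type*} [MeasurableSpace 𝒴] (n : ℕ) (K : ℝ) (P : Measure (Fin n → ℝ))
    (W : (Fin n → ℝ) → 𝒴 → ℝ) (ν : Measure ((Fin n → ℝ) × 𝒴)) [IsProbabilityMeasure ν]
    (sn a : ℝ) : ℝ := a * meanOv n P W ν sn a + 3 * K ^ 2 * a

lemma Mdl.p_mono (M : Mdl n K P ν W) (hs : sn ∈ Set.Ioc (0:ℝ) 1) (hn : 0 < n) :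
    Monotone (pfun n K P W ν sn) := by
  intro a b hab
  rcases hab.eq_or_lt with rfl | h
  · exact le_rfl
  have h1 := M.f_lower hs hn a (b - a)
  have h2 := M.f_lower hs hn b (a - b)
  rw [add_sub_cancel] at h1 h2
  unfold pfun
  have h3 : 0 < b - a := by linarith
  have : (b - a) * (a * meanOv n P W ν sn a - b * meanOv n P W ν sn b - 3 * K ^ 2 * (b - a)) ≤ 0 := by
    nlinarith
  have := nonpos_of_mul_nonpos_right this h3
  linarith

lemma Mdl.p_bd (M : Mdl n K P ν W) (hs : sn ∈ Set.Ioc (0:ℝ) 1) {a : ℝ} (ha : |a| ≤ 3) :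
    |pfun n K P W ν sn a| ≤ 12 * K ^ 2 := by
  unfold pfun
  have h := M.meanOv_bd hs a
  refine (abs_add_le _ _).trans ?_
  rw [abs_mul, abs_mul, abs_of_nonneg (by positivity : 0 ≤ 3 * K ^ 2)]
  have : |a| * |meanOv n P W ν sn a| ≤ 3 * K ^ 2 := by gcongr
  have : 3 * K ^ 2 * |a| ≤ 3 * K ^ 2 * 3 := by gcongr
  linarith

lemma Mdl.conc (M : Mdl n K P ν W) (hs : sn ∈ Set.Ioc (0:ℝ) 1) (hn : 0 < n) {a δ : ℝ}
    (ha : a ∈ Set.Icc (1:ℝ) 2) (hδ : 0 < δ) (hδ' : δ ≤ 1 / 2) :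
    δ * EG n P W ν sn a (fun ω x => |hU n sn a ω.1.1 ω.2 x - a * meanOv n P W ν sn a|)
      ≤ Real.log 2 / (n * sn) + 3 / 2 * K ^ 2 * δ ^ 2
        + (δ * (pfun n K P W ν sn (a + δ) - pfun n K P W ν sn (a - δ))
          + 3 * vnPert n P W ν sn) := by
  set c := a * meanOv n P W ν sn a with hc
  set f : ℝ → ℝ := fun b => ∫ ω, phiPert n P W sn b ω ∂(pertSpace n ν) with hf
  have nUc : Nice K P W (fun ω x => |hU n sn a ω.1.1 ω.2 x - c|) := by
    have := ((Nice.U M hs hn a).add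
      (Bdd.const (𝒴 := 𝒴) (K := K) (P := P) (W := W) (-c)).nice).abs
    simpa only [← sub_eq_add_neg] using this
  have iA : ∀ b, Integrable (fun ω => |phiPert n P W sn b ω - f b|) (pertSpace n ν) := fun b =>
    ((M.phi_int hs b).sub (integrable_const _)).abs
  have va : ∀ b ∈ Set.Icc (1 / 2 : ℝ) 3,
      ∫ ω, |phiPert n P W sn b ω - f b| ∂(pertSpace n ν) ≤ vnPert n P W ν sn := fun b hb =>
    M.v_le hs hb
  have v1 := va (a + δ) ⟨by linarith [ha.1], by linarith [ha.2]⟩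
  have v2 := va (a - δ) ⟨by linarith [ha.1], by linarith [ha.2]⟩
  have v3 := va a ⟨by linarith [ha.1], by linarith [ha.2]⟩
  have hKδ : 0 ≤ 3 / 2 * K ^ 2 * δ ^ 2 := by positivity
  have pm := M.p_mono (P := P) (W := W) (ν := ν) hs hn
  have pm1 := pm (by linarith : a ≤ a + δ)
  have pm2 := pm (by linarith : a - δ ≤ a)
  have g1 : f (a + δ) - f a - δ * c ≤ δ * (pfun n K P W ν sn (a + δ) - pfun n K P W ν sn a) := by
    have h := M.f_lower hs hn (a + δ) (-δ)
    rw [add_neg_cancel_right] at h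
    simp only [pfun, hf, hc]
    nlinarith
  have g2 : f (a - δ) - f a + δ * c ≤ δ * (pfun n K P W ν sn a - pfun n K P W ν sn (a - δ)) := by
    have h := M.f_lower hs hn (a - δ) δ
    rw [sub_add_cancel] at h
    simp only [pfun, hf, hc]
    nlinarith
  set D := δ * (pfun n K P W ν sn (a + δ) - pfun n K P W ν sn (a - δ)) with hD
  have g1' : f (a + δ) - f a - δ * c ≤ D := g1.trans (by rw [hD]; gcongr)
  have g2' : f (a - δ) - f a + δ * c ≤ D := g2.trans (by rw [hD]; gcongr)
  have iE : Integrable (fun ω => (Real.log 2 / (n * sn) + 3 / 2 * K ^ 2 * δ ^ 2 + D)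
      + ((|phiPert n P W sn (a + δ) ω - f (a + δ)| + |phiPert n P W sn (a - δ) ω - f (a - δ)|)
        + |phiPert n P W sn a ω - f a|)) (pertSpace n ν) :=
    (integrable_const _).add (((iA _).add (iA _)).add (iA _))
  have key : ∫ ω, δ * gibbsPert n P W sn a ω (fun x => |hU n sn a ω.1.1 ω.2 x - c|)
      ∂(pertSpace n ν) ≤ ∫ ω, ((Real.log 2 / (n * sn) + 3 / 2 * K ^ 2 * δ ^ 2 + D)
      + ((|phiPert n P W sn (a + δ) ω - f (a + δ)| + |phiPert n P W sn (a - δ) ω - f (a - δ)|)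
        + |phiPert n P W sn a ω - f a|)) ∂(pertSpace n ν) := by
    refine integral_mono_ae ((M.nice_int hs a nUc).const_mul _) iE ?_
    filter_upwards [M.good_ae'] with ω G
    have a1 := abs_le.mp (le_refl |phiPert n P W sn (a + δ) ω - f (a + δ)|)
    have a2 := abs_le.mp (le_refl |phiPert n P W sn (a - δ) ω - f (a - δ)|)
    have a3 := abs_le.mp (le_refl |phiPert n P W sn a ω - f a|)
    have b1 := abs_nonneg (phiPert n P W sn (a + δ) ω - f (a + δ))
    have b2 := abs_nonneg (phiPert n P W sn (a - δ) ω - f (a - δ))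
    have h := M.U_dev hs hn a δ c (D + ((|phiPert n P W sn (a + δ) ω - f (a + δ)|
      + |phiPert n P W sn (a - δ) ω - f (a - δ)|) + |phiPert n P W sn a ω - f a|)) G ω.2
      (by simp only [Prod.mk.eta]; linarith [a1.1, a1.2, a3.1, a3.2])
      (by simp only [Prod.mk.eta]; linarith [a2.1, a2.2, a3.1, a3.2])
    simp only [Prod.mk.eta] at h
    linarith
  have j2 : Integrable (fun ω => |phiPert n P W sn (a + δ) ω - f (a + δ)|
      + |phiPert n P W sn (a - δ) ω - f (a - δ)|) (pertSpace n ν) := (iA _).add (iA _)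
  have j3 : Integrable (fun ω => (|phiPert n P W sn (a + δ) ω - f (a + δ)|
      + |phiPert n P W sn (a - δ) ω - f (a - δ)|) + |phiPert n P W sn a ω - f a|)
      (pertSpace n ν) := j2.add (iA _)
  rw [integral_const_mul, integral_add (integrable_const _) j3,
    integral_add j2 (iA _), integral_add (iA _) (iA _)] at key
  simp only [integral_const, probReal_univ, smul_eq_mul, one_mul] at key
  unfold EG
  linarith

lemma Mdl.final (M : Mdl n K P ν W) (hs : sn ∈ Set.Ioc (0:ℝ) 1) (hn : 0 < n) {δ : ℝ}
    (hδ : 0 < δ) (hδ' : δ ≤ 1 / 2) :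
    0 ≤ ∫ a in (1:ℝ)..2, VarOv n P W ν sn a ∧
    ∫ a in (1:ℝ)..2, VarOv n P W ν sn a ≤ K ^ 2 *
      ((Real.log 2 / (n * sn) + 3 * vnPert n P W ν sn) / δ + (3 / 2 * K ^ 2 + 48 * K ^ 2) * δ) := by
  have h12 : (1:ℝ) ≤ 2 := by norm_num
  have h0 : 0 ≤ ∫ a in (1:ℝ)..2, VarOv n P W ν sn a :=
    intervalIntegral.integral_nonneg h12 fun a _ => M.Var_nonneg a
  refine ⟨h0, ?_⟩
  have hN : 0 < (n:ℝ) * sn := mul_pos (by exact_mod_cast hn) hs.1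
  have hlog : 0 < Real.log 2 := Real.log_pos (by norm_num)
  have hv : 0 ≤ vnPert n P W ν sn := by
    refine le_trans (integral_nonneg fun ω => abs_nonneg _)
      (M.v_le hs (a := 1) ⟨by norm_num, by norm_num⟩)
  have hR : 0 ≤ K ^ 2 *
      ((Real.log 2 / (n * sn) + 3 * vnPert n P W ν sn) / δ + (3 / 2 * K ^ 2 + 48 * K ^ 2) * δ) := by
    positivity
  by_cases hi : IntervalIntegrable (fun a => VarOv n P W ν sn a) volume 1 2
  swap
  · rw [intervalIntegral.integral_undef hi]; exact hR
  have pm := M.p_mono (P := P) (W := W) (ν := ν) hs hn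
  set p := pfun n K P W ν sn with hp
  have ip : ∀ x y, IntervalIntegrable p volume x y := fun x y => pm.intervalIntegrable
  have ip1 : IntervalIntegrable (fun a => p (a + δ)) volume 1 2 :=
    (pm.comp (g := p) (f := fun a => a + δ) (fun x y h => by simpa using h)).intervalIntegrable
  have ip2 : IntervalIntegrable (fun a => p (a - δ)) volume 1 2 :=
    (pm.comp (g := p) (f := fun a => a - δ) (fun x y h => by simpa using h)).intervalIntegrable
  set B := (Real.log 2 / (n * sn) + 3 * vnPert n P W ν sn) / δ + 3 / 2 * K ^ 2 * δ with hB
  have pt : ∀ a ∈ Set.Icc (1:ℝ) 2, VarOv n P W ν sn a ≤ K ^ 2 * (B + (p (a + δ) - p (a - δ))) := by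
    intro a ha
    have h1 := M.Var_le hs hn ha.1 (P := P) (W := W) (ν := ν)
    have h2 := M.conc hs hn ha hδ hδ'
    refine h1.trans ?_
    gcongr
    rw [← mul_le_mul_iff_right₀ hδ]
    refine h2.trans (le_of_eq ?_)
    rw [hB]
    field_simp
    ring
  have step : ∫ a in (1:ℝ)..2, VarOv n P W ν sn a
      ≤ ∫ a in (1:ℝ)..2, K ^ 2 * (B + (p (a + δ) - p (a - δ))) :=
    intervalIntegral.integral_mono_on h12 hi
      ((intervalIntegrable_const.add (ip1.sub ip2)).const_mul _) pt
  have e1 : ∫ a in (1:ℝ)..2, (p (a + δ) - p (a - δ))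
      = (∫ a in (2 - δ)..(2 + δ), p a) - ∫ a in (1 - δ)..(1 + δ), p a := by
    rw [intervalIntegral.integral_sub ip1 ip2, intervalIntegral.integral_comp_add_right,
      intervalIntegral.integral_comp_sub_right,
      ← intervalIntegral.integral_add_adjacent_intervals (ip (1 - δ) (1 + δ)) (ip (1 + δ) (2 - δ)),
      ← intervalIntegral.integral_add_adjacent_intervals (ip (1 + δ) (2 - δ)) (ip (2 - δ) (2 + δ))]
    ring
  have b1 : ‖∫ a in (2 - δ)..(2 + δ), p a‖ ≤ 12 * K ^ 2 * |2 + δ - (2 - δ)| := by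
    refine intervalIntegral.norm_integral_le_of_norm_le_const fun x hx => ?_
    rw [Set.uIoc_of_le (by linarith)] at hx
    exact M.p_bd hs (abs_le.mpr ⟨by linarith [hx.1], by linarith [hx.2]⟩)
  have b2 : ‖∫ a in (1 - δ)..(1 + δ), p a‖ ≤ 12 * K ^ 2 * |1 + δ - (1 - δ)| := by
    refine intervalIntegral.norm_integral_le_of_norm_le_const fun x hx => ?_
    rw [Set.uIoc_of_le (by linarith)] at hx
    exact M.p_bd hs (abs_le.mpr ⟨by linarith [hx.1], by linarith [hx.2]⟩)
  have q1 : |2 + δ - (2 - δ)| = 2 * δ := by rw [abs_of_pos (by linarith)]; ring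
  have q2 : |1 + δ - (1 - δ)| = 2 * δ := by rw [abs_of_pos (by linarith)]; ring
  rw [norm_eq_abs, q1] at b1
  rw [norm_eq_abs, q2] at b2
  have e2 : ∫ a in (1:ℝ)..2, K ^ 2 * (B + (p (a + δ) - p (a - δ)))
      = K ^ 2 * (B + ∫ a in (1:ℝ)..2, (p (a + δ) - p (a - δ))) := by
    rw [intervalIntegral.integral_const_mul,
      intervalIntegral.integral_add intervalIntegrable_const (ip1.sub ip2)]
    simp only [intervalIntegral.integral_const, smul_eq_mul]
    norm_num
  refine step.trans ?_
  rw [e2, e1]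
  have b1' := (abs_le.mp b1).2
  have b2' := (abs_le.mp b2).1
  have : B + ((∫ a in (2 - δ)..(2 + δ), p a) - ∫ a in (1 - δ)..(1 + δ), p a)
      ≤ (Real.log 2 / (n * sn) + 3 * vnPert n P W ν sn) / δ + (3 / 2 * K ^ 2 + 48 * K ^ 2) * δ := by
    rw [hB]; linarith
  gcongr

end

lemma tendsto_of_bound (v N I : ℕ → ℝ) (A C : ℝ) (hA : 0 ≤ A) (hC : 0 ≤ C)
    (hv : Tendsto v atTop (𝓝 0)) (hN : Tendsto N atTop atTop)
    (h : ∀ δ : ℝ, 0 < δ → δ ≤ 1 / 2 → ∀ᶠ k in atTop, 0 ≤ I k ∧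
      I k ≤ A * ((Real.log 2 / N k + 3 * v k) / δ + C * δ)) :
    Tendsto I atTop (𝓝 0) := by
  rw [Metric.tendsto_atTop']
  intro ε hε
  obtain ⟨δ, hδ, hδ2, hδε⟩ : ∃ δ : ℝ, 0 < δ ∧ δ ≤ 1 / 2 ∧ A * (C * δ) < ε / 2 := by
    refine ⟨min (1 / 2) (ε / (4 * (A * C + 1))), ?_, min_le_left _ _, ?_⟩
    · positivity
    · have h1 : min (1 / 2) (ε / (4 * (A * C + 1))) ≤ ε / (4 * (A * C + 1)) := min_le_right _ _
      have h2 : A * C * (ε / (4 * (A * C + 1))) ≤ ε / 4 := by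
        rw [← mul_div_assoc, div_le_div_iff₀ (by positivity) (by norm_num)]
        nlinarith
      calc _ ≤ A * (C * (ε / (4 * (A * C + 1)))) := by gcongr
        _ = A * C * (ε / (4 * (A * C + 1))) := by ring
        _ ≤ ε / 4 := h2
        _ < ε / 2 := by linarith
  have t1 : Tendsto (fun k => A * ((Real.log 2 / N k + 3 * v k) / δ + C * δ)) atTop
      (𝓝 (A * ((0 + 3 * 0) / δ + C * δ))) :=
    ((((tendsto_const_nhds.div_atTop hN).add (hv.const_mul 3)).div_const δ).add_const _).const_mul A
  have t2 : ∀ᶠ k in atTop, A * ((Real.log 2 / N k + 3 * v k) / δ + C * δ) < ε :=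
    t1.eventually_lt_const (by simp; linarith)
  have := (h δ hδ hδ2).and t2
  obtain ⟨k0, hk0⟩ := eventually_atTop.mp this
  refine ⟨k0, fun k hk => ?_⟩
  obtain ⟨⟨p1, p2⟩, p3⟩ := hk0 k hk.le
  rw [Real.dist_eq, sub_zero, abs_of_nonneg p1]
  linarith

/-- **General overlap concentration.**  If `v_n(s_n) → 0` and `n·s_n → ∞`, then
`∫₁² E⟨(x⁽¹⁾·x⁽²⁾ − E⟨x⁽¹⁾·x⁽²⁾⟩)²⟩ da → 0`. -/
theorem general_overlap_concentration
    {𝒴 : ℕ → Type*} [∀ n, MeasurableSpace (𝒴 n)]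
    (K₁ : ℝ) (hK₁ : 0 < K₁)
    (P₁ : ∀ n, Measure (Fin n → ℝ)) [∀ n, IsProbabilityMeasure (P₁ n)]
    (ν : ∀ n, Measure ((Fin n → ℝ) × 𝒴 n)) [∀ n, IsProbabilityMeasure (ν n)]
    (W : ∀ n, (Fin n → ℝ) → 𝒴 n → ℝ)
    (hWmeas : ∀ n, Measurable fun p : (Fin n → ℝ) × 𝒴 n => W n p.1 p.2)
    (hWpos : ∀ n x y, 0 ≤ W n x y)
    (hmarg : ∀ n, (ν n).map Prod.fst = P₁ n)
    (hsupp : ∀ n, ∀ᵐ x ∂(P₁ n), ∀ i, |x i| ≤ K₁)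
    (hZint : ∀ n, Integrable (fun y => ∫ x, W n x y ∂(P₁ n)) ((ν n).map Prod.snd))
    (hlogZint : ∀ n,
      Integrable (fun y => Real.log (∫ x, W n x y ∂(P₁ n))) ((ν n).map Prod.snd))
    (hcond : ∀ n (f : (Fin n → ℝ) × 𝒴 n → ℝ), Measurable f → (∃ C : ℝ, ∀ p, |f p| ≤ C) →
      ∫ p, f p ∂(ν n)
        = ∫ y, (∫ x, f (x, y) * W n x y ∂(P₁ n)) / (∫ x, W n x y ∂(P₁ n))
            ∂((ν n).map Prod.snd))
    (s : ℕ → ℝ) (hs : ∀ n, s n ∈ Set.Ioc (0 : ℝ) 1)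
    (hv : Tendsto (fun n => vnPert n (P₁ n) (W n) (ν n) (s n)) atTop (𝓝 0))
    (hns : Tendsto (fun n : ℕ => (n : ℝ) * s n) atTop atTop) :
    Tendsto
      (fun n =>
        ∫ a in (1 : ℝ)..2,
          ∫ ω, gibbsPert n (P₁ n) (W n) (s n) a ω
              (fun x1 => gibbsPert n (P₁ n) (W n) (s n) a ω
                (fun x2 => (ovl n x1 x2 - meanOv n (P₁ n) (W n) (ν n) (s n) a) ^ 2))
            ∂(pertSpace n (ν n)))
      atTop (𝓝 0) := by
  refine tendsto_of_bound (fun n => vnPert n (P₁ n) (W n) (ν n) (s n)) (fun n => (n : ℝ) * s n)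
    _ (K₁ ^ 2) (3 / 2 * K₁ ^ 2 + 48 * K₁ ^ 2) (by positivity) (by positivity) hv hns
    fun δ hδ hδ' => ?_
  filter_upwards [eventually_gt_atTop 0] with n hn
  have M : Mdl n K₁ (P₁ n) (ν n) (W n) :=
    ⟨hK₁, hWmeas n, hWpos n, hmarg n, hsupp n, hlogZint n, hcond n⟩
  exact M.final (hs n) hn hδ hδ'
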